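/- arXiv:2502.10791 — 2 statements merged into one kernel-verified Lean document; each statement's English description precedes it below -/
import Mathlib

section
/- Let H′ = −Σ_{u∈Λ} (J_x X_u X_{u+e_x} + J_y Y_u Y_{u+e_y} + h_x X_u + h_y Y_u + h_z Z_u) be the quantum compass Hamiltonian with an arbitrary uniform magnetic field (h_x,h_y,h_z) ∈ ℝ³, with J_x ≠ 0 and J_y ≠ 0. Then for every 1 ≤ k̄ ≤ L/2, the only local conserved quantities of H′ with diagonal length k̄ are constant multiples of H′. -/
open Complex Matrix

/-- Sites of the `L × L` square lattice with periodic boundary conditions. -/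
abbrev Site (L : ℕ) := ZMod L × ZMod L

/-- A specification of a product of Pauli matrices: at each site either
`0` (no operator), `1` (`X`), `2` (`Y`) or `3` (`Z`). -/
abbrev PSpec (L : ℕ) := Site L → Fin 4

/-- Operators on the Hilbert space `⊗_{u ∈ Λ} ℂ²`. -/
abbrev Op (L : ℕ) := Matrix (Site L → Fin 2) (Site L → Fin 2) ℂ

/-- The Pauli matrices (`0` gives the identity). -/
noncomputable def pauli (w : Fin 4) : Matrix (Fin 2) (Fin 2) ℂ :=
  if w = 1 then !![0, 1; 1, 0]
  else if w = 2 then !![0, -Complex.I; Complex.I, 0]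
  else if w = 3 then !![1, 0; 0, -1]
  else 1

/-- The product of Pauli matrices specified by `σ`, as an operator (matrix)
on the full Hilbert space. -/
noncomputable def PauliOp (L : ℕ) [NeZero L] (σ : PSpec L) : Op L :=
  fun s t => ∏ u : Site L, pauli (σ u) (s u) (t u)

/-- `DiagBoundAt L σ a k` : every site `u` in the support of `σ` satisfies
`0 ≤ uₓ + u_y − a ≤ k − 1 (mod L)`. -/
def DiagBoundAt (L : ℕ) (σ : PSpec L) (a : ZMod L) (k : ℕ) : Prop :=
  ∀ u : Site L, σ u ≠ 0 → (u.1 + u.2 - a).val < k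

/-- The diagonal length of a Pauli product. -/
noncomputable def Diag (L : ℕ) (σ : PSpec L) : ℕ :=
  sInf {k | ∃ a : ZMod L, DiagBoundAt L σ a k}

/-- `X_u` as a Pauli-product specification. -/
def sigX (L : ℕ) (u : Site L) : PSpec L := fun v => if v = u then 1 else 0
/-- `Y_u` as a Pauli-product specification. -/
def sigY (L : ℕ) (u : Site L) : PSpec L := fun v => if v = u then 2 else 0
/-- `Z_u` as a Pauli-product specification. -/
def sigZ (L : ℕ) (u : Site L) : PSpec L := fun v => if v = u then 3 else 0
/-- A single-site Pauli operator `W_u` (`w ∈ {1,2,3}`). -/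
def sigW (L : ℕ) (u : Site L) (w : Fin 4) : PSpec L := fun v => if v = u then w else 0

/-- `X_u X_{u+eₓ}` as a Pauli-product specification. -/
def sigXX (L : ℕ) (u : Site L) : PSpec L :=
  fun v => if v = u then 1 else if v = u + (1, 0) then 1 else 0
/-- `Y_u Y_{u+e_y}` as a Pauli-product specification. -/
def sigYY (L : ℕ) (u : Site L) : PSpec L :=
  fun v => if v = u then 2 else if v = u + (0, 1) then 2 else 0

/-- The quantum compass Hamiltonian
`H = −Σ_u (Jx X_u X_{u+eₓ} + Jy Y_u Y_{u+e_y})`. -/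
noncomputable def Hcompass (L : ℕ) [NeZero L] (Jx Jy : ℝ) : Op L :=
  - ∑ u : Site L, ((Jx : ℂ) • PauliOp L (sigXX L u) + (Jy : ℂ) • PauliOp L (sigYY L u))

/-- The quantum compass Hamiltonian with a uniform magnetic field. -/
noncomputable def Hfield (L : ℕ) [NeZero L] (Jx Jy hx hy hz : ℝ) : Op L :=
  - ∑ u : Site L,
      ((Jx : ℂ) • PauliOp L (sigXX L u) + (Jy : ℂ) • PauliOp L (sigYY L u)
        + (hx : ℂ) • PauliOp L (sigX L u) + (hy : ℂ) • PauliOp L (sigY L u)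
        + (hz : ℂ) • PauliOp L (sigZ L u))

/-- The candidate conserved quantity `Q = Σ_σ q_σ σ`. -/
noncomputable def Qop (L : ℕ) [NeZero L] (q : PSpec L → ℂ) : Op L :=
  ∑ σ : PSpec L, q σ • PauliOp L σ

/-- Commutator of operators. -/
noncomputable def opComm (L : ℕ) [NeZero L] (A B : Op L) : Op L := A * B - B * A

/-- The coefficient `λ_{σ,τ}` of the Pauli product `τ` in the expansion
`[H, σ] = Σ_τ λ_{σ,τ} τ`, extracted via the (normalized) trace inner product. -/
noncomputable def lam (L : ℕ) [NeZero L] (H : Op L) (σ τ : PSpec L) : ℂ :=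
  Matrix.trace (PauliOp L τ * opComm L H (PauliOp L σ)) / (2 ^ Fintype.card (Site L))

/-- `u` is a top-right site of `σ` (relative to the witness `a` for diagonal
length `k`). -/
def IsTopRight (L : ℕ) (σ : PSpec L) (a : ZMod L) (k : ℕ) (u : Site L) : Prop :=
  σ u ≠ 0 ∧ (u.1 + u.2 - a).val = k - 1

/-- `u` is a bottom-left site of `σ` (relative to the witness `a`). -/
def IsBottomLeft (L : ℕ) (σ : PSpec L) (a : ZMod L) (u : Site L) : Prop :=
  σ u ≠ 0 ∧ (u.1 + u.2 - a).val = 0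

/-- Condition (1): `σ` has a unique top-right site `ū`, with
(1a) `σ_ū = X` and `ū − eₓ ∈ Supp σ`, or (1b) `σ_ū = Y` and `ū − e_y ∈ Supp σ`. -/
def Cond1 (L : ℕ) (σ : PSpec L) (a : ZMod L) (k : ℕ) : Prop :=
  ∃ ub : Site L, (∀ v : Site L, IsTopRight L σ a k v ↔ v = ub) ∧
    ((σ ub = 1 ∧ σ (ub - (1, 0)) ≠ 0) ∨ (σ ub = 2 ∧ σ (ub - (0, 1)) ≠ 0))

/-- Condition (2): `σ` has a unique bottom-left site `u̲`, with
(2a) `σ_u̲ = X` and `u̲ + eₓ ∈ Supp σ`, or (2b) `σ_u̲ = Y` and `u̲ + e_y ∈ Supp σ`. -/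
def Cond2 (L : ℕ) (σ : PSpec L) (a : ZMod L) : Prop :=
  ∃ lb : Site L, (∀ v : Site L, IsBottomLeft L σ a v ↔ v = lb) ∧
    ((σ lb = 1 ∧ σ (lb + (1, 0)) ≠ 0) ∨ (σ lb = 2 ∧ σ (lb + (0, 1)) ≠ 0))

/-- `ShiftRel L k σ σ'` : `σ` has diagonal length `k`, satisfies conditions (1)
and (2), and `σ'` is the Shiraishi shift `S(σ)`, obtained by first appending a
site at the top right (the product `B`) and then truncating the bottom-left site. -/
def ShiftRel (L : ℕ) [NeZero L] (k : ℕ) (σ σ' : PSpec L) : Prop :=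
  Diag L σ = k ∧ σ' ≠ 0 ∧
  ∃ a : ZMod L, DiagBoundAt L σ a k ∧
  ∃ ub lb : Site L,
    (∀ v : Site L, IsTopRight L σ a k v ↔ v = ub) ∧
    (∀ v : Site L, IsBottomLeft L σ a v ↔ v = lb) ∧
    ∃ B : Op L,
      ((σ ub = 1 ∧ σ (ub - (1, 0)) ≠ 0 ∧
          B = (-(1 / (2 * Complex.I))) • opComm L (PauliOp L (sigYY L ub)) (PauliOp L σ)) ∨
       (σ ub = 2 ∧ σ (ub - (0, 1)) ≠ 0 ∧
          B = (1 / (2 * Complex.I)) • opComm L (PauliOp L (sigXX L ub)) (PauliOp L σ))) ∧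
      ∃ ε : ℂ, (ε = 1 / (2 * Complex.I) ∨ ε = -(1 / (2 * Complex.I))) ∧
        ((σ lb = 1 ∧ σ (lb + (1, 0)) ≠ 0 ∧
            PauliOp L σ' = ε • opComm L (PauliOp L (sigXX L lb)) B) ∨
         (σ lb = 2 ∧ σ (lb + (0, 1)) ≠ 0 ∧
            PauliOp L σ' = ε • opComm L (PauliOp L (sigYY L lb)) B))

/-- The staircase sequence `u_j`: `u_j = u₁ + ((j−1)/2)(eₓ+e_y)` for odd `j`,
and `u_j = u₁ + (j/2)(eₓ+e_y) − e_y` for even `j`. -/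
def stair (L : ℕ) (u1 : Site L) (j : ℕ) : Site L :=
  if j % 2 = 1 then
    u1 + ((((j - 1) / 2 : ℕ) : ZMod L), (((j - 1) / 2 : ℕ) : ZMod L))
  else
    u1 + (((j / 2 : ℕ) : ZMod L), ((j / 2 : ℕ) : ZMod L)) - ((0 : ZMod L), (1 : ZMod L))

/-- The Pauli letter at the first (bottom-left) end of `C^k_j`. -/
def endL (j : ℕ) : Fin 4 := if j % 2 = 1 then 1 else 2

/-- The Pauli letter at the last (top-right) end of `C^k_j`. -/
def endR (k j : ℕ) : Fin 4 :=
  if k % 2 = 1 then (if j % 2 = 1 then 2 else 1)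
  else (if j % 2 = 1 then 1 else 2)

/-- The standard-form product `C^k_j` based at `u₁`: the appropriate end
letters at `u_j` and `u_{j+k−1}`, and `Z` at `u_{j+1}, …, u_{j+k−2}`. -/
def Cspec (L : ℕ) (k j : ℕ) (u1 : Site L) : PSpec L := fun v =>
  if v = stair L u1 j then endL j
  else if v = stair L u1 (j + k - 1) then endR k j
  else if v ∈ (Finset.Icc (j + 1) (j + k - 2)).image (stair L u1) then 3
  else 0

/-! ### Pauli algebra -/

/-- The sign of the cyclic order of two Pauli letters; it is `0` when they commute. -/
def sgn (a b : Fin 4) : ℤ :=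
  if a = 0 ∨ b = 0 ∨ a = b then 0
  else if (a = 1 ∧ b = 2) ∨ (a = 2 ∧ b = 3) ∨ (a = 3 ∧ b = 1) then 1
  else -1

/-- The phase in the product of two Pauli letters. -/
noncomputable def ph (a b : Fin 4) : ℂ :=
  if sgn a b = 0 then 1 else (sgn a b : ℂ) * Complex.I

lemma pauli_mul (a b : Fin 4) : pauli a * pauli b = ph a b • pauli (a ^^^ b) := by
  fin_cases a <;> fin_cases b <;> ext i j <;> fin_cases i <;> fin_cases j <;>
    simp [pauli, ph, sgn, Matrix.mul_apply, Fin.sum_univ_two]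

/-- The product of two Pauli products, up to a phase. -/
def pmul {L : ℕ} (σ τ : PSpec L) : PSpec L := fun v => σ v ^^^ τ v

lemma letter_xor_assoc : ∀ a b c : Fin 4, (a ^^^ b) ^^^ c = a ^^^ (b ^^^ c) := by decide
lemma letter_xor_comm : ∀ a b : Fin 4, a ^^^ b = b ^^^ a := by decide
lemma letter_xor_self : ∀ a : Fin 4, a ^^^ a = 0 := by decide
lemma letter_zero_xor : ∀ a : Fin 4, 0 ^^^ a = a := by decide
lemma letter_xor_zero : ∀ a : Fin 4, a ^^^ 0 = a := by decide
lemma letter_xor_eq_zero : ∀ a b : Fin 4, a ^^^ b = 0 ↔ a = b := by decide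

section
variable {L : ℕ}

lemma pmul_apply (σ τ : PSpec L) (v : Site L) : pmul σ τ v = σ v ^^^ τ v := rfl

lemma pmul_comm (σ τ : PSpec L) : pmul σ τ = pmul τ σ :=
  funext fun _ => letter_xor_comm _ _

lemma pmul_assoc (ρ σ τ : PSpec L) : pmul (pmul ρ σ) τ = pmul ρ (pmul σ τ) :=
  funext fun _ => letter_xor_assoc _ _ _

lemma pmul_left_comm (ρ σ τ : PSpec L) : pmul ρ (pmul σ τ) = pmul σ (pmul ρ τ) := by
  rw [← pmul_assoc, pmul_comm ρ σ, pmul_assoc]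

lemma pmul_cancel (σ τ : PSpec L) : pmul σ (pmul σ τ) = τ := by
  funext v
  simp [pmul, ← letter_xor_assoc, letter_zero_xor]

/-- Multiplication by a fixed Pauli product as an involution. -/
def pmulEquiv (β : PSpec L) : PSpec L ≃ PSpec L where
  toFun := pmul β
  invFun := pmul β
  left_inv := pmul_cancel β
  right_inv := pmul_cancel β

variable [NeZero L]

/-- The phase in the product of two Pauli products. -/
noncomputable def phase (σ τ : PSpec L) : ℂ := ∏ u, ph (σ u) (τ u)

lemma PauliOp_mul (σ τ : PSpec L) :
    PauliOp L σ * PauliOp L τ = phase σ τ • PauliOp L (pmul σ τ) := by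
  ext s t
  have h : ∀ u, ph (σ u) (τ u) * pauli (σ u ^^^ τ u) (s u) (t u)
      = ∑ x, pauli (σ u) (s u) x * pauli (τ u) x (t u) := by
    intro u
    rw [← Matrix.mul_apply, pauli_mul, Matrix.smul_apply, smul_eq_mul]
  simp only [Matrix.mul_apply, Matrix.smul_apply, PauliOp, phase, smul_eq_mul, pmul,
    ← Finset.prod_mul_distrib, h]
  rw [Finset.prod_univ_sum, Fintype.piFinset_univ]

lemma trace_PauliOp (σ : PSpec L) (hσ : σ ≠ 0) : Matrix.trace (PauliOp L σ) = 0 := by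
  have h : Matrix.trace (PauliOp L σ) = ∏ u, ∑ x, pauli (σ u) x x := by
    rw [Finset.prod_univ_sum, Fintype.piFinset_univ]
    rfl
  obtain ⟨u, hu⟩ : ∃ u, σ u ≠ 0 := by
    by_contra! h0
    exact hσ (funext h0)
  rw [h]
  refine Finset.prod_eq_zero (Finset.mem_univ u) ?_
  generalize σ u = a at hu
  fin_cases a <;> simp_all [pauli, Fin.sum_univ_two]

lemma PauliOp_zero : PauliOp L 0 = 1 := by
  ext s t
  simp only [PauliOp, Matrix.one_apply, funext_iff]
  by_cases h : s = t
  · subst h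
    simp [pauli]
  · obtain ⟨u, hu⟩ := Function.ne_iff.mp h
    rw [if_neg (fun h' => hu (h' u))]
    refine Finset.prod_eq_zero (Finset.mem_univ u) ?_
    simp [pauli, hu]

lemma phase_self (σ : PSpec L) : phase σ σ = 1 := by
  simp [phase, ph, sgn]

lemma Qop_eq_zero {c : PSpec L → ℂ} (h : Qop L c = 0) (τ : PSpec L) : c τ = 0 := by
  have h1 : Matrix.trace (PauliOp L τ * Qop L c) = 0 := by rw [h]; simp
  rw [Qop, Finset.mul_sum, Matrix.trace_sum, Finset.sum_eq_single τ] at h1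
  · rw [Matrix.mul_smul, PauliOp_mul, phase_self, one_smul, Matrix.trace_smul] at h1
    have h2 : pmul τ τ = 0 := funext fun v => letter_xor_self _
    rw [h2, PauliOp_zero, Matrix.trace_one] at h1
    simpa using h1
  · intro σ _ hσ
    rw [Matrix.mul_smul, PauliOp_mul, Matrix.trace_smul, Matrix.trace_smul, trace_PauliOp]
    · simp
    · intro h0
      exact hσ (funext fun v => ((letter_xor_eq_zero _ _).mp (congrFun h0 v)).symm)
  · simp

lemma opComm_PauliOp_Qop (β : PSpec L) (q : PSpec L → ℂ) :
    opComm L (PauliOp L β) (Qop L q)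
      = Qop L fun τ => (phase β (pmul β τ) - phase (pmul β τ) β) * q (pmul β τ) := by
  rw [opComm, Qop, Qop, Finset.mul_sum, Finset.sum_mul, ← Finset.sum_sub_distrib,
    ← (pmulEquiv β).sum_comp]
  refine Finset.sum_congr rfl fun τ _ => ?_
  change PauliOp L β * (q (pmul β τ) • PauliOp L (pmul β τ))
    - (q (pmul β τ) • PauliOp L (pmul β τ)) * PauliOp L β = _
  rw [Matrix.mul_smul, Matrix.smul_mul, PauliOp_mul, PauliOp_mul, pmul_comm (pmul β τ) β,
    pmul_cancel, smul_smul, smul_smul, ← sub_smul]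
  congr 1
  ring

/-! ### Bonds -/

/-- The Pauli letter of a bond direction (`true` is horizontal). -/
def dl (p : Bool) : Fin 4 := if p then 1 else 2

/-- The lattice vector of a bond direction. -/
def de (L : ℕ) (p : Bool) : Site L := if p then (1, 0) else (0, 1)

/-- The two-site Pauli product on the bond from `u` in direction `p`. -/
def bspec (p : Bool) (u : Site L) : PSpec L :=
  fun v => if v = u then dl p else if v = u + de L p then dl p else 0

/-- The coefficient (divided by `2 * I`) of a Pauli product with letters `a`, `b` at the two ends
of a bond with letter `p` in the commutator with that bond. -/
def kap (p a b : Fin 4) : ℤ :=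
  if a = 0 ∨ a = p then sgn p (p ^^^ b)
  else if b = 0 ∨ b = p then sgn p (p ^^^ a) else 0

/-- The contribution of a bond to the coefficient of `τ` in the commutator. -/
noncomputable def bondTerm (J : Bool → ℂ) (q : PSpec L → ℂ) (τ : PSpec L)
    (b : Bool × Site L) : ℂ :=
  J b.1 * kap (dl b.1) (τ b.2) (τ (b.2 + de L b.1)) * q (pmul (bspec b.1 b.2) τ)

/-- The bond part of the conservation equations. -/
def BondConserved (J : Bool → ℂ) (q : PSpec L → ℂ) : Prop :=
  ∀ τ : PSpec L, (∀ σ : PSpec L, (∀ v, σ v = 0 ↔ τ v = 0) → q σ = 0) →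
    ∑ b, bondTerm J q τ b = 0

omit [NeZero L] in
lemma one_ne_zero_of_two_le (hL : 2 ≤ L) : (1 : ZMod L) ≠ 0 := by
  have : Fact (1 < L) := ⟨hL⟩
  exact one_ne_zero

omit [NeZero L] in
lemma add_de_ne (hL : 2 ≤ L) (p : Bool) (u : Site L) : u + de L p ≠ u := by
  have h := one_ne_zero_of_two_le hL
  cases p <;> simp [de, Prod.ext_iff, h]

lemma ph_zero_left (a : Fin 4) : ph 0 a = 1 := by simp [ph, sgn]
lemma ph_zero_right (a : Fin 4) : ph a 0 = 1 := by simp [ph, sgn]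

lemma phase_bond_left (hL : 2 ≤ L) (p : Bool) (u : Site L) (σ : PSpec L) :
    phase (bspec p u) σ = ph (dl p) (σ u) * ph (dl p) (σ (u + de L p)) := by
  have hne := add_de_ne hL p u
  rw [phase, Fintype.prod_eq_mul u (u + de L p) hne.symm]
  · simp [bspec]
  · rintro v ⟨h1, h2⟩
    simp [bspec, h1, h2, ph_zero_left]

lemma phase_bond_right (hL : 2 ≤ L) (p : Bool) (u : Site L) (σ : PSpec L) :
    phase σ (bspec p u) = ph (σ u) (dl p) * ph (σ (u + de L p)) (dl p) := by
  have hne := add_de_ne hL p u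
  rw [phase, Fintype.prod_eq_mul u (u + de L p) hne.symm]
  · simp [bspec]
  · rintro v ⟨h1, h2⟩
    simp [bspec, h1, h2, ph_zero_right]

lemma ph_sub_ph (p : Bool) (a b : Fin 4) :
    ph (dl p) (dl p ^^^ a) * ph (dl p) (dl p ^^^ b) - ph (dl p ^^^ a) (dl p) * ph (dl p ^^^ b) (dl p)
      = 2 * Complex.I * kap (dl p) a b := by
  cases p <;> fin_cases a <;> fin_cases b <;> simp [ph, sgn, kap, dl] <;> ring

lemma phase_bond_sub (hL : 2 ≤ L) (p : Bool) (u : Site L) (τ : PSpec L) :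
    phase (bspec p u) (pmul (bspec p u) τ) - phase (pmul (bspec p u) τ) (bspec p u)
      = 2 * Complex.I * kap (dl p) (τ u) (τ (u + de L p)) := by
  have hne := add_de_ne hL p u
  rw [phase_bond_left hL, phase_bond_right hL, ← ph_sub_ph]
  simp [pmul, bspec]

lemma phase_field_sub (w : Fin 4) (u : Site L) (q : PSpec L → ℂ) (τ : PSpec L)
    (hq : ∀ σ : PSpec L, (∀ v, σ v = 0 ↔ τ v = 0) → q σ = 0) :
    (phase (sigW L u w) (pmul (sigW L u w) τ) - phase (pmul (sigW L u w) τ) (sigW L u w))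
      * q (pmul (sigW L u w) τ) = 0 := by
  have h1 : phase (sigW L u w) (pmul (sigW L u w) τ) = ph w (w ^^^ τ u) := by
    rw [phase, Fintype.prod_eq_single u]
    · simp [pmul, sigW]
    · intro v hv
      simp [sigW, hv, ph_zero_left]
  have h2 : phase (pmul (sigW L u w) τ) (sigW L u w) = ph (w ^^^ τ u) w := by
    rw [phase, Fintype.prod_eq_single u]
    · simp [pmul, sigW]
    · intro v hv
      simp [sigW, hv, ph_zero_right]
  rw [h1, h2]
  by_cases hc : w ^^^ τ u = 0 ↔ τ u = 0
  · rw [hq, mul_zero]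
    intro v
    by_cases hv : v = u
    · subst hv
      simpa [pmul, sigW] using hc
    · simp [pmul, sigW, hv, letter_zero_xor]
  · have h3 : ph w (w ^^^ τ u) = ph (w ^^^ τ u) w := by
      generalize τ u = a at hc
      revert hc
      fin_cases w <;> fin_cases a <;> simp [ph, sgn]
    rw [h3, sub_self, zero_mul]

lemma Qop_sum {ι : Type*} (s : Finset ι) (f : ι → PSpec L → ℂ) :
    ∑ i ∈ s, Qop L (f i) = Qop L fun τ => ∑ i ∈ s, f i τ := by
  simp only [Qop]
  rw [Finset.sum_comm]
  simp only [Finset.sum_smul]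

lemma Qop_add (f g : PSpec L → ℂ) : Qop L f + Qop L g = Qop L fun τ => f τ + g τ := by
  simp only [Qop, ← Finset.sum_add_distrib, add_smul]

lemma Qop_smul (c : ℂ) (f : PSpec L → ℂ) : c • Qop L f = Qop L fun τ => c * f τ := by
  simp only [Qop, Finset.smul_sum, smul_smul]

lemma opComm_add_left (A B C : Op L) : opComm L (A + B) C = opComm L A C + opComm L B C := by
  simp only [opComm, add_mul, mul_add]
  abel

lemma opComm_smul_left (c : ℂ) (A C : Op L) : opComm L (c • A) C = c • opComm L A C := by
  simp only [opComm, Matrix.smul_mul, Matrix.mul_smul, smul_sub]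

lemma opComm_neg_sum_left {ι : Type*} (s : Finset ι) (A : ι → Op L) (C : Op L) :
    opComm L (-∑ i ∈ s, A i) C = -∑ i ∈ s, opComm L (A i) C := by
  simp only [opComm, neg_mul, mul_neg, Finset.sum_mul, Finset.mul_sum, Finset.sum_sub_distrib]
  abel

/-- The couplings as a function of the bond direction. -/
def coupling (Jx Jy : ℝ) (p : Bool) : ℂ := if p then (Jx : ℂ) else (Jy : ℂ)

lemma bondConserved_of_opComm (hL : 2 ≤ L) {Jx Jy hx hy hz : ℝ} {q : PSpec L → ℂ}
    (h : opComm L (Hfield L Jx Jy hx hy hz) (Qop L q) = 0) :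
    BondConserved (coupling Jx Jy) q := by
  intro τ hτ
  have eX : ∀ u, sigXX L u = bspec true u := fun u => rfl
  have eY : ∀ u, sigYY L u = bspec false u := fun u => rfl
  have fX : ∀ u, sigX L u = sigW L u 1 := fun u => rfl
  have fY : ∀ u, sigY L u = sigW L u 2 := fun u => rfl
  have fZ : ∀ u, sigZ L u = sigW L u 3 := fun u => rfl
  simp only [Hfield, opComm_neg_sum_left, neg_eq_zero, opComm_add_left, opComm_smul_left,
    eX, eY, fX, fY, fZ, opComm_PauliOp_Qop, Qop_smul, Qop_add, Qop_sum] at h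
  have h1 := Qop_eq_zero h τ
  simp only [phase_field_sub _ _ _ _ hτ, phase_bond_sub hL, mul_zero, add_zero] at h1
  rw [Fintype.sum_prod_type, Fintype.sum_bool, ← Finset.sum_add_distrib]
  have h2 : (2 * Complex.I) * ∑ u, (bondTerm (coupling Jx Jy) q τ (true, u)
      + bondTerm (coupling Jx Jy) q τ (false, u)) = 0 := by
    rw [← h1, Finset.mul_sum]
    refine Finset.sum_congr rfl fun u _ => ?_
    simp only [bondTerm, coupling]
    simp only [if_true, Bool.false_eq_true, if_false]
    ring
  simpa using h2

end

/-! ### Diagonal rows -/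

section
variable {L : ℕ}

/-- The diagonal coordinate of a site relative to the diagonal `r`. -/
def off (r : ZMod L) (v : Site L) : ℕ := (v.1 + v.2 - r).val

lemma diag_add_de (p : Bool) (v : Site L) :
    (v + de L p).1 + (v + de L p).2 = v.1 + v.2 + 1 := by
  cases p <;> simp [de] <;> ring

lemma de_ne_de (hL : 2 ≤ L) (p : Bool) : de L p ≠ de L (!p) := by
  have h := one_ne_zero_of_two_le hL
  cases p <;> simp [de, Prod.ext_iff, h]

lemma dl_not_xor_dl : ∀ p : Bool, dl (!p) ^^^ dl p = 3 := by decide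

lemma dl_injective : ∀ p p' : Bool, dl p = dl p' → p = p' := by decide

variable [NeZero L]

lemma off_lt (r : ZMod L) (v : Site L) : off r v < L := ZMod.val_lt _

omit [NeZero L] in
lemma off_add_de (hL : 2 ≤ L) {r : ZMod L} {v : Site L} (p : Bool) (h : off r v + 1 < L) :
    off r (v + de L p) = off r v + 1 := by
  have : Fact (1 < L) := ⟨hL⟩
  have h1 : (v + de L p).1 + (v + de L p).2 - r = (v.1 + v.2 - r) + 1 := by
    rw [diag_add_de]; ring
  rw [off, h1, ZMod.val_add_of_lt, ZMod.val_one]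
  · rfl
  · rw [ZMod.val_one]; exact h

lemma off_sub_de (hL : 2 ≤ L) {r : ZMod L} {v : Site L} (p : Bool) (h : 0 < off r v) :
    off r (v - de L p) = off r v - 1 := by
  have h2 := off_lt r (v - de L p)
  by_cases h3 : off r (v - de L p) + 1 < L
  · have := off_add_de hL p h3
    rw [sub_add_cancel] at this
    omega
  · exfalso
    have h4 : (((off r (v - de L p) + 1 : ℕ)) : ZMod L) = 0 := by
      rw [show off r (v - de L p) + 1 = L by omega]; simp
    have h5 : v.1 + v.2 - r = ((off r (v - de L p) + 1 : ℕ) : ZMod L) := by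
      have := diag_add_de p (v - de L p)
      rw [sub_add_cancel] at this
      rw [Nat.cast_add, off, ZMod.natCast_zmod_val, this]
      push_cast
      ring
    rw [h4] at h5
    rw [off, h5] at h
    simp at h

omit [NeZero L] in
lemma off_eq_zero_iff {r : ZMod L} {v : Site L} : off r v = 0 ↔ v.1 + v.2 = r := by
  rw [off, ZMod.val_eq_zero, sub_eq_zero]

omit [NeZero L] in
lemma off_rebase {a r : ZMod L} {v₀ v : Site L} (h₀ : off r v₀ = 0)
    (h : off a v₀ + off r v < L) : off a v = off a v₀ + off r v := by
  rw [off_eq_zero_iff] at h₀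
  have h1 : v.1 + v.2 - a = (v₀.1 + v₀.2 - a) + (v.1 + v.2 - r) := by rw [h₀]; ring
  rw [off, h1, ZMod.val_add_of_lt]
  · rfl
  · exact h

/-- All Pauli products in the expansion `q` fit in `k` consecutive diagonals. -/
def RangeLE (k : ℕ) (q : PSpec L → ℂ) : Prop :=
  ∀ σ : PSpec L, q σ ≠ 0 → ∃ a, DiagBoundAt L σ a k

variable {k : ℕ} {q : PSpec L → ℂ} {J : Bool → ℂ}

omit [NeZero L] in
lemma RangeLE.false_of_far (hq : RangeLE k q) (hkL : 2 * k ≤ L) {σ : PSpec L} (hσ : q σ ≠ 0)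
    {r : ZMod L} {v w : Site L} (hv : off r v = 0) (hv' : σ v ≠ 0) (hw : off r w = k)
    (hw' : σ w ≠ 0) : False := by
  obtain ⟨a, ha⟩ := hq σ hσ
  have h1 : off a v < k := ha v hv'
  have h2 : off a w < k := ha w hw'
  have := off_rebase (a := a) (v := w) hv (by omega)
  omega

omit [NeZero L] in
lemma RangeLE.bound (hq : RangeLE k q) (hkL : 2 * k ≤ L) {σ : PSpec L} (hσ : q σ ≠ 0)
    {r : ZMod L} {v w : Site L} (hv : off r v = 0) (hv' : σ v ≠ 0) (hw : off r w = k - 1)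
    (hw' : σ w ≠ 0) : ∀ x, σ x ≠ 0 → off r x < k := by
  obtain ⟨a, ha⟩ := hq σ hσ
  have h1 : off a v < k := ha v hv'
  have h2 : off a w < k := ha w hw'
  have h3 := off_rebase (a := a) (v := w) hv (by omega)
  have h4 : off a v = 0 := by omega
  rw [off_eq_zero_iff] at h4 hv
  rw [← hv, h4]
  exact ha

/-! ### Action of a bond -/

omit [NeZero L] in
lemma bspec_apply_of_ne {p : Bool} {u v : Site L} (h1 : v ≠ u) (h2 : v ≠ u + de L p) :
    bspec p u v = 0 := by
  simp [bspec, h1, h2]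

omit [NeZero L] in
lemma bspec_left (p : Bool) (u : Site L) : bspec p u u = dl p := by simp [bspec]

omit [NeZero L] in
lemma bspec_right (p : Bool) (u : Site L) : bspec p u (u + de L p) = dl p := by simp [bspec]

omit [NeZero L] in
lemma pmul_bspec_of_ne {p : Bool} {u v : Site L} (σ : PSpec L) (h1 : v ≠ u)
    (h2 : v ≠ u + de L p) : pmul (bspec p u) σ v = σ v := by
  rw [pmul_apply, bspec_apply_of_ne h1 h2, letter_zero_xor]

omit [NeZero L] in
lemma pmul_bspec_left (p : Bool) (u : Site L) (σ : PSpec L) :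
    pmul (bspec p u) σ u = dl p ^^^ σ u := by
  rw [pmul_apply, bspec_left]

omit [NeZero L] in
lemma pmul_bspec_right (p : Bool) (u : Site L) (σ : PSpec L) :
    pmul (bspec p u) σ (u + de L p) = dl p ^^^ σ (u + de L p) := by
  rw [pmul_apply, bspec_right]

lemma kap_ne_zero : ∀ (p : Bool) (a b : Fin 4), kap (dl p) a b ≠ 0 →
    (a ≠ 0 ∧ a ≠ dl p ∧ (b = 0 ∨ b = dl p)) ∨ (b ≠ 0 ∧ b ≠ dl p ∧ (a = 0 ∨ a = dl p)) := by
  decide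

lemma dl_xor_ne_zero : ∀ (p : Bool) (a : Fin 4), a ≠ dl p → dl p ^^^ a ≠ 0 := by decide

omit [NeZero L] in
/-- A contributing bond keeps one of its end sites `y` in the support and toggles the other end
site `z`. -/
lemma bondTerm_ne_zero {τ : PSpec L} {p : Bool} {u : Site L}
    (h : bondTerm J q τ (p, u) ≠ 0) :
    q (pmul (bspec p u) τ) ≠ 0 ∧ ∃ y z, ((y = u ∧ z = u + de L p) ∨ (z = u ∧ y = u + de L p)) ∧
      τ y ≠ 0 ∧ τ y ≠ dl p ∧ (τ z = 0 ∨ τ z = dl p) ∧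
      ∀ v, v ≠ z → τ v ≠ 0 → pmul (bspec p u) τ v ≠ 0 := by
  have hq : q (pmul (bspec p u) τ) ≠ 0 := right_ne_zero_of_mul h
  have hk : kap (dl p) (τ u) (τ (u + de L p)) ≠ 0 := by
    intro h0
    simp [bondTerm, h0] at h
  refine ⟨hq, ?_⟩
  rcases kap_ne_zero _ _ _ hk with ⟨h1, h2, h3⟩ | ⟨h1, h2, h3⟩
  · refine ⟨u, u + de L p, Or.inl ⟨rfl, rfl⟩, h1, h2, h3, fun v hv hτ => ?_⟩
    by_cases hvu : v = u
    · subst hvu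
      rw [pmul_bspec_left]
      exact dl_xor_ne_zero _ _ h2
    · rwa [pmul_bspec_of_ne _ hvu hv]
  · refine ⟨u + de L p, u, Or.inr ⟨rfl, rfl⟩, h1, h2, h3, fun v hv hτ => ?_⟩
    by_cases hvu : v = u + de L p
    · subst hvu
      rw [pmul_bspec_right]
      exact dl_xor_ne_zero _ _ h2
    · rwa [pmul_bspec_of_ne _ hv hvu]

/-- A contributing bond either keeps both extreme diagonals occupied, or removes the only site on
one of them. -/
lemma bondTerm_ne_zero_edge (hL : 2 ≤ L) {N : ℕ} (hN : N + 1 < L) {r : ZMod L} {τ : PSpec L}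
    (hwin : ∀ v, τ v ≠ 0 → off r v ≤ N) {v₀ w₀ : Site L} (hv₀ : off r v₀ = 0) (hv₀' : τ v₀ ≠ 0)
    (hw₀ : off r w₀ = N) (hw₀' : τ w₀ ≠ 0) {p : Bool} {u : Site L}
    (h : bondTerm J q τ (p, u) ≠ 0) :
    ((∃ v, off r v = 0 ∧ pmul (bspec p u) τ v ≠ 0) ∧
        ∃ w, off r w = N ∧ pmul (bspec p u) τ w ≠ 0) ∨
      (off r u = 0 ∧ τ u = dl p ∧ (∀ v, off r v = 0 → v ≠ u → τ v = 0) ∧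
        τ (u + de L p) ≠ 0 ∧ τ (u + de L p) ≠ dl p) ∨
      (off r (u + de L p) = N ∧ τ (u + de L p) = dl p ∧
        (∀ v, off r v = N → v ≠ u + de L p → τ v = 0) ∧ τ u ≠ 0 ∧ τ u ≠ dl p) := by
  obtain ⟨-, y, z, hyz, hy, hy', hz, hrest⟩ := bondTerm_ne_zero h
  have hzero : ∀ i, (∀ v, off r v = i → pmul (bspec p u) τ v = 0) →
      ∀ v, off r v = i → τ v ≠ 0 → v = z := by
    intro i hi v hv hτ
    by_contra hne
    exact hrest v hne hτ (hi v hv)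
  by_cases hb : ∃ v, off r v = 0 ∧ pmul (bspec p u) τ v ≠ 0
  · by_cases ht : ∃ w, off r w = N ∧ pmul (bspec p u) τ w ≠ 0
    · exact Or.inl ⟨hb, ht⟩
    · right; right
      push Not at ht
      have hz0 := hzero N ht w₀ hw₀ hw₀'
      subst hz0
      rcases hyz with ⟨rfl, rfl⟩ | ⟨rfl, rfl⟩
      · refine ⟨hw₀, hz.resolve_left hw₀', fun v hv hne => ?_, hy, hy'⟩
        by_contra hτ
        exact hne (hzero N ht v hv hτ)
      · have h1 := off_add_de hL (r := r) (v := w₀) p (by omega)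
        have h2 := hwin _ hy
        omega
  · right; left
    push Not at hb
    have hz0 := hzero 0 hb v₀ hv₀ hv₀'
    subst hz0
    rcases hyz with ⟨rfl, rfl⟩ | ⟨rfl, rfl⟩
    · have h2 := hwin _ hy
      have h1 := off_add_de hL (r := r) (v := y) p (by omega)
      omega
    · refine ⟨hv₀, hz.resolve_left hv₀', fun v hv hne => ?_, hy, hy'⟩
      by_contra hτ
      exact hne (hzero 0 hb v hv hτ)

lemma kap_left_ne_zero : ∀ (p : Bool) (a : Fin 4), a ≠ 0 → a ≠ dl p →
    kap (dl p) (dl p ^^^ a) (dl p) ≠ 0 := by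
  decide

/-- Extending a product in the expansion by a bond at the top must be compensated by removing its
bottom site. -/
lemma extend_top (hkL : 2 * k ≤ L) (hk : 2 ≤ k) (hJ : ∀ p, J p ≠ 0) (hq : RangeLE k q)
    (hc : BondConserved J q) {σ : PSpec L} (hσ : q σ ≠ 0) {r : ZMod L} {v₀ : Site L}
    (hv₀ : off r v₀ = 0) (hv₀' : σ v₀ ≠ 0) {p : Bool} {u : Site L} (hu : off r u = k - 1)
    (hu' : σ u ≠ 0) (hup : σ u ≠ dl p) :
    ∃ p' z, off r z = 0 ∧ σ z = dl p' ∧ (∀ v, off r v = 0 → v ≠ z → σ v = 0) ∧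
      pmul (bspec p u) σ (z + de L p') ≠ 0 ∧ pmul (bspec p u) σ (z + de L p') ≠ dl p' ∧
      q (pmul (bspec p' z) (pmul (bspec p u) σ)) ≠ 0 := by
  have hL : 2 ≤ L := by omega
  have hwin := hq.bound hkL hσ hv₀ hv₀' hu hu'
  have hue : off r (u + de L p) = k := by
    rw [off_add_de hL p (by omega), hu]; omega
  have hue0 : σ (u + de L p) = 0 := by
    by_contra h0
    have := hwin _ h0
    omega
  set τ := pmul (bspec p u) σ with hτ
  have hτ1 : ∀ v, off r v < k - 1 → τ v = σ v := by
    intro v hv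
    refine pmul_bspec_of_ne σ ?_ ?_ <;> rintro rfl <;> omega
  have hτu : τ u = dl p ^^^ σ u := pmul_bspec_left p u σ
  have hτue : τ (u + de L p) = dl p := by
    rw [hτ, pmul_bspec_right, hue0, letter_xor_zero]
  have hdl : dl p ≠ 0 := by cases p <;> decide
  have hτwin : ∀ v, τ v ≠ 0 → off r v ≤ k := by
    intro v hv
    by_cases h1 : v = u
    · subst h1; omega
    by_cases h2 : v = u + de L p
    · subst h2; omega
    rw [hτ, pmul_bspec_of_ne σ h1 h2] at hv
    exact (hwin v hv).le
  have hτv₀ : τ v₀ ≠ 0 := by rwa [hτ1 v₀ (by omega)]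
  have hsum := hc τ fun ρ hρ => by
    by_contra h0
    exact hq.false_of_far hkL h0 hv₀ (fun h => hτv₀ ((hρ _).mp h)) hue
      (fun h => hdl (by rw [← hτue]; exact (hρ _).mp h))
  have hne : bondTerm J q τ (p, u) ≠ 0 := by
    simp only [bondTerm, hτu, hτue]
    refine mul_ne_zero (mul_ne_zero (hJ p) ?_) ?_
    · exact_mod_cast kap_left_ne_zero p _ hu' hup
    · rwa [hτ, pmul_cancel]
  obtain ⟨⟨p', z⟩, hne1, hne2⟩ : ∃ b, b ≠ (p, u) ∧ bondTerm J q τ b ≠ 0 := by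
    by_contra! hall
    rw [Fintype.sum_eq_single (p, u) hall] at hsum
    exact hne hsum
  have hq2 := (bondTerm_ne_zero hne2).1
  rcases bondTerm_ne_zero_edge hL (by omega) hτwin hv₀ hτv₀ hue (by rwa [hτue]) hne2 with
    ⟨⟨v, hv, hv'⟩, w, hw, hw'⟩ | ⟨h1, h2, h3, h4, h5⟩ | ⟨h1, h2, h3, h4, h5⟩
  · exact (hq.false_of_far hkL hq2 hv hv' hw hw').elim
  · refine ⟨p', z, h1, ?_, ?_, h4, h5, hq2⟩
    · rw [← h2, hτ1 z (by omega)]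
    · intro v hv hvz
      rw [← hτ1 v (by omega)]
      exact h3 v hv hvz
  · exfalso
    have h6 : u + de L p = z + de L p' := by
      by_contra hh
      exact hdl (hτue ▸ h3 _ hue hh)
    rw [← h6, hτue] at h2
    have := dl_injective _ _ h2
    subst this
    exact hne1 (by rw [add_right_cancel h6])

/-! ### Point reflection -/

/-- The coefficients of the point-reflected operator. -/
def reflectCoeff (q : PSpec L → ℂ) : PSpec L → ℂ := fun σ => q fun v => σ (-v)

omit [NeZero L] in
lemma bspec_neg (p : Bool) (u : Site L) :
    (fun v => bspec p u (-v)) = bspec p (-u - de L p) := by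
  funext v
  have h1 : -v = u ↔ v = -u - de L p + de L p := by
    rw [sub_add_cancel, neg_eq_iff_eq_neg]
  have h2 : -v = u + de L p ↔ v = -u - de L p := by
    rw [neg_eq_iff_eq_neg, neg_add']
  simp only [bspec, h1, h2]
  by_cases h3 : v = -u - de L p <;> by_cases h4 : v = -u - de L p + de L p <;> simp [h3, h4]

omit [NeZero L] in
lemma pmul_bspec_neg (p : Bool) (u : Site L) (σ : PSpec L) :
    (fun v => pmul (bspec p u) σ (-v)) = pmul (bspec p (-u - de L p)) fun v => σ (-v) := by
  rw [← bspec_neg]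
  rfl

lemma kap_comm : ∀ p a b : Fin 4, p ≠ 0 → kap p a b = kap p b a := by decide

/-- Reflection of bonds. -/
def bondNeg (L : ℕ) : Bool × Site L ≃ Bool × Site L where
  toFun b := (b.1, -b.2 - de L b.1)
  invFun b := (b.1, -b.2 - de L b.1)
  left_inv b := by simp
  right_inv b := by simp

lemma BondConserved.reflect (hc : BondConserved J q) : BondConserved J (reflectCoeff q) := by
  intro τ hτ
  have h1 := hc (fun v => τ (-v)) fun σ hσ => by
    have := hτ (fun v => σ (-v)) fun v => by simpa using hσ (-v)
    simpa [reflectCoeff] using this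
  rw [← (bondNeg L).sum_comp] at h1
  rw [← h1]
  refine Finset.sum_congr rfl fun b _ => ?_
  obtain ⟨p, u⟩ := b
  have hdl : dl p ≠ 0 := by cases p <;> decide
  simp only [bondTerm, bondNeg, Equiv.coe_fn_mk, reflectCoeff, pmul_bspec_neg]
  rw [kap_comm _ _ _ hdl]
  congr 4 <;> congr 1 <;> abel_nf

lemma off_neg {r : ZMod L} {v : Site L} {n : ℕ} (hn : n < L) (h : off r v ≤ n) :
    off (-(r + (n : ZMod L))) (-v) = n - off r v := by
  have h1 : (-v).1 + (-v).2 - -(r + (n : ZMod L)) = ((n - off r v : ℕ) : ZMod L) := by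
    rw [Nat.cast_sub h, off, ZMod.natCast_zmod_val]
    simp only [Prod.fst_neg, Prod.snd_neg]
    ring
  rw [off, h1, ZMod.val_natCast_of_lt (by omega)]

lemma RangeLE.reflect (hq : RangeLE k q) (hk : 1 ≤ k) (hkL : k ≤ L) :
    RangeLE k (reflectCoeff q) := by
  intro σ hσ
  obtain ⟨a, ha⟩ := hq _ hσ
  refine ⟨-(a + ((k - 1 : ℕ) : ZMod L)), fun v hv => ?_⟩
  have h1 : off a (-v) < k := ha (-v) (by simpa using hv)
  have h2 := off_neg (r := a) (v := -v) (n := k - 1) (by omega) (by omega)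
  rw [neg_neg] at h2
  change off _ v < k
  omega

/-- Extending a product in the expansion by a bond at the bottom must be compensated by removing
its top site. -/
lemma extend_bottom (hkL : 2 * k ≤ L) (hk : 2 ≤ k) (hJ : ∀ p, J p ≠ 0) (hq : RangeLE k q)
    (hc : BondConserved J q) {σ : PSpec L} (hσ : q σ ≠ 0) {r : ZMod L} {w₀ : Site L}
    (hw₀ : off r w₀ = k - 1) (hw₀' : σ w₀ ≠ 0) {p : Bool} {u : Site L} (hu : off r u = 0)
    (hu' : σ u ≠ 0) (hup : σ u ≠ dl p) :
    ∃ p' z, off r z = k - 1 ∧ σ z = dl p' ∧ (∀ v, off r v = k - 1 → v ≠ z → σ v = 0) ∧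
      pmul (bspec p (u - de L p)) σ (z - de L p') ≠ 0 ∧
      pmul (bspec p (u - de L p)) σ (z - de L p') ≠ dl p' ∧
      q (pmul (bspec p' (z - de L p')) (pmul (bspec p (u - de L p)) σ)) ≠ 0 := by
  have hn : k - 1 < L := by omega
  have e1 := off_neg (r := r) (v := w₀) hn (by omega)
  have e2 := off_neg (r := r) (v := u) hn (by omega)
  obtain ⟨p', z, h1, h2, h3, h4, h5, h6⟩ := extend_top hkL hk hJ (hq.reflect (by omega) (by omega))
    hc.reflect (σ := fun v => σ (-v)) (r := -(r + ((k - 1 : ℕ) : ZMod L))) (v₀ := -w₀) (u := -u)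
    (p := p) (by simpa [reflectCoeff] using hσ) (by omega) (by simpa using hw₀') (by omega)
    (by simpa using hu') (by simpa using hup)
  have e3 : (pmul (bspec p (-u)) fun v => σ (-v))
      = fun v => pmul (bspec p (u - de L p)) σ (-v) := by
    rw [pmul_bspec_neg]
    congr 2
    abel
  have e4 : -(z + de L p') = -z - de L p' := by abel
  rw [e3] at h4 h5 h6
  simp only [e4] at h4 h5
  refine ⟨p', -z, ?_, h2, fun v hv hne => ?_, h4, h5, ?_⟩
  · have e5 := off_neg (v := z) hn (h1.trans_le (Nat.zero_le _))
    rw [neg_add, neg_neg, add_neg_cancel_right] at e5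
    omega
  · have e6 := off_neg (v := v) hn hv.le
    have := h3 (-v) (by omega) (by rintro rfl; simp at hne)
    simpa using this
  · rw [reflectCoeff, pmul_bspec_neg p' z] at h6
    simpa only [neg_neg] using h6

end

/-! ### Staircases -/

section
variable {L : ℕ}

/-- The direction of the `i`-th step of a staircase. -/
def dir (i : ℤ) : Bool := decide (i % 2 = 0)

/-- The `i`-th site of the staircase through `u`. -/
def stairSite (u : Site L) (i : ℤ) : Site L :=
  u + ((((i + 1) / 2 : ℤ) : ZMod L), ((i / 2 : ℤ) : ZMod L))

lemma dir_succ (i : ℤ) : dir (i + 1) = !dir i := by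
  simp only [dir]
  by_cases h : i % 2 = 0
  · have : ¬ (i + 1) % 2 = 0 := by omega
    simp [h, this]
  · have : (i + 1) % 2 = 0 := by omega
    simp [h, this]

lemma stairSite_succ (u : Site L) (i : ℤ) :
    stairSite u (i + 1) = stairSite u i + de L (dir i) := by
  by_cases h : i % 2 = 0
  · have h1 : (i + 1 + 1) / 2 = (i + 1) / 2 + 1 := by omega
    have h2 : (i + 1) / 2 = i / 2 := by omega
    simp only [stairSite, dir, de, h, h1, h2]
    ext <;> simp [add_assoc]
  · have h1 : (i + 1 + 1) / 2 = (i + 1) / 2 := by omega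
    have h2 : (i + 1) / 2 = i / 2 + 1 := by omega
    simp only [stairSite, dir, de, h, h1, h2]
    ext <;> simp [add_assoc]

lemma exists_stairSite_eq (u : Site L) (p : Bool) :
    ∃ u₀ T, stairSite u₀ T = u ∧ dir (T - 1) = p := by
  refine ⟨u - stairSite 0 (if p then 1 else 0), if p then 1 else 0, ?_, ?_⟩
  · simp [stairSite]
  · cases p <;> rfl

/-- The product of `n` consecutive bonds of a staircase. -/
def path (u : Site L) (m : ℤ) : ℕ → PSpec L
  | 0 => 0
  | n + 1 => pmul (bspec (dir (m + n)) (stairSite u (m + n))) (path u m n)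

lemma path_succ' (u : Site L) (m : ℤ) (n : ℕ) :
    path u m (n + 1) = pmul (bspec (dir m) (stairSite u m)) (path u (m + 1) n) := by
  induction n with
  | zero => simp [path]
  | succ n ih =>
    rw [path, ih, path, pmul_left_comm]
    congr 4 <;> push_cast <;> ring_nf

variable [NeZero L]

omit [NeZero L] in
lemma off_stairSite (hL : 2 ≤ L) {r : ZMod L} {u : Site L} {m : ℤ} (h : off r (stairSite u m) = 0)
    {j : ℕ} (hj : j < L) : off r (stairSite u (m + j)) = j := by
  induction j with
  | zero => simpa using h
  | succ j ih =>
    have h1 := ih (by omega)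
    rw [Nat.cast_succ, ← add_assoc, stairSite_succ, off_add_de hL _ (by omega), h1]

omit [NeZero L] in
lemma stairSite_injOn (hL : 2 ≤ L) (u : Site L) (m : ℤ) {i j : ℕ} (hi : i < L) (hj : j < L)
    (h : stairSite u (m + i) = stairSite u (m + j)) : i = j := by
  have h0 : off ((stairSite u m).1 + (stairSite u m).2) (stairSite u m) = 0 :=
    off_eq_zero_iff.mpr rfl
  rw [← off_stairSite hL h0 hi, h, off_stairSite hL h0 hj]

omit [NeZero L] in
lemma path_eq_zero {u : Site L} {m : ℤ} {n : ℕ} {v : Site L}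
    (h : ∀ j : ℕ, j ≤ n → v ≠ stairSite u (m + j)) : path u m n v = 0 := by
  induction n with
  | zero => rfl
  | succ n ih =>
    rw [path, pmul_bspec_of_ne]
    · exact ih fun j hj => h j (by omega)
    · exact h n (by omega)
    · rw [← stairSite_succ]
      have := h (n + 1) le_rfl
      rwa [Nat.cast_succ, ← add_assoc] at this

omit [NeZero L] in
lemma path_stairSite (hL : 2 ≤ L) (u : Site L) (m : ℤ) {n j : ℕ} (hn : n < L) (hj : j < L) :
    path u m n (stairSite u (m + j)) = (if j < n then dl (dir (m + j)) else 0) ^^^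
      (if 1 ≤ j ∧ j ≤ n then dl (dir (m + j - 1)) else 0) := by
  induction n with
  | zero =>
    rw [if_neg (by omega), if_neg (by omega)]
    rfl
  | succ n ih =>
    have h1 := ih (by omega)
    rw [path]
    by_cases hjn : j = n
    · subst hjn
      rw [pmul_bspec_left, h1]
      simp only [lt_self_iff_false, if_false, le_refl, and_true, letter_zero_xor,
        Nat.lt_succ_self, if_true, Nat.le_succ]
    · by_cases hjn1 : j = n + 1
      · subst hjn1
        have e : m + ((n + 1 : ℕ) : ℤ) = m + n + 1 := by push_cast; ring
        rw [e, stairSite_succ, pmul_bspec_right, ← stairSite_succ, ← e, h1]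
        have e2 : m + ((n + 1 : ℕ) : ℤ) - 1 = m + n := by push_cast; ring
        rw [e2, if_neg (by omega), if_neg (by omega), if_neg (by omega), if_pos (by omega)]
        simp only [letter_zero_xor, letter_xor_zero]
      · rw [pmul_bspec_of_ne, h1]
        · have e1 : j < n + 1 ↔ j < n := by omega
          have e2 : j ≤ n + 1 ↔ j ≤ n := by omega
          simp only [e1, e2]
        · intro h
          exact hjn (stairSite_injOn hL u m hj (by omega) h)
        · rw [← stairSite_succ, add_assoc, ← Nat.cast_succ]
          intro h
          exact hjn1 (stairSite_injOn hL u m hj hn h)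

omit [NeZero L] in
lemma path_bottom (hL : 2 ≤ L) (u : Site L) (m : ℤ) {n : ℕ} (hn : n < L) (h1 : 1 ≤ n) :
    path u m n (stairSite u m) = dl (dir m) := by
  have h := path_stairSite hL u m (j := 0) hn (by omega)
  rw [if_pos (by omega), if_neg (by omega), letter_xor_zero] at h
  simpa using h

omit [NeZero L] in
lemma path_top (hL : 2 ≤ L) (u : Site L) (m : ℤ) {n : ℕ} (hn : n < L) (h1 : 1 ≤ n) :
    path u m n (stairSite u (m + n)) = dl (dir (m + n - 1)) := by
  rw [path_stairSite hL u m hn hn, if_neg (by omega), if_pos (by omega), letter_zero_xor]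

omit [NeZero L] in
lemma path_interior (hL : 2 ≤ L) (u : Site L) (m : ℤ) {n j : ℕ} (hn : n < L) (h1 : 1 ≤ j)
    (hj : j < n) : path u m n (stairSite u (m + j)) = 3 := by
  rw [path_stairSite hL u m hn (by omega), if_pos (by omega), if_pos (by omega)]
  have : m + j = m + j - 1 + 1 := by ring
  rw [this, dir_succ, add_sub_cancel_right, dl_not_xor_dl]

omit [NeZero L] in
/-- A product is a staircase path if its sites and letters on each diagonal are. -/
lemma eq_path (hL : 2 ≤ L) {u : Site L} {m : ℤ} {n : ℕ} (hn : n < L) (h1 : 1 ≤ n) {r : ZMod L}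
    {σ : PSpec L} (hwin : ∀ v, σ v ≠ 0 → off r v ≤ n)
    (hrow : ∀ j : ℕ, j ≤ n → ∀ v, off r v = j → v ≠ stairSite u (m + j) → σ v = 0)
    (hbot : σ (stairSite u m) = dl (dir m))
    (htop : σ (stairSite u (m + n)) = dl (dir (m + n - 1)))
    (hmid : ∀ j : ℕ, 1 ≤ j → j < n → σ (stairSite u (m + j)) = 3) : σ = path u m n := by
  funext v
  by_cases hv : ∃ j : ℕ, j ≤ n ∧ v = stairSite u (m + j)
  · obtain ⟨j, hj, rfl⟩ := hv
    rcases Nat.eq_zero_or_pos j with rfl | hj0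
    · simp only [Nat.cast_zero, add_zero]
      rw [hbot, path_bottom hL u m hn h1]
    · rcases hj.eq_or_lt with rfl | hjn
      · rw [htop, path_top hL u m hn h1]
      · rw [hmid j hj0 hjn, path_interior hL u m hn hj0 hjn]
  · push Not at hv
    rw [path_eq_zero hv]
    by_contra h0
    have h2 := hwin v h0
    exact h0 (hrow _ h2 v rfl (hv _ h2))

end

/-! ### Products of maximal diagonal length -/

section
variable {L : ℕ} [NeZero L] {k : ℕ} {q : PSpec L → ℂ} {J : Bool → ℂ}

lemma exists_dl_ne : ∀ a : Fin 4, ∃ p, a ≠ dl p := by decide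

lemma letter_of_xor_eq_dl : ∀ (p p' : Bool) (a : Fin 4), a ≠ 0 → a ≠ dl p →
    dl p ^^^ a = dl p' → a = 3 ∧ p' = !p := by decide

lemma dl_ne_zero : ∀ p : Bool, dl p ≠ 0 := by decide
lemma dl_ne_dl_not : ∀ p : Bool, dl p ≠ dl (!p) := by decide
lemma dl_ne_three : ∀ p : Bool, dl p ≠ 3 := by decide

/-- Extending at the bottom and removing the top site produces a product in the expansion whose
diagonals are shifted down by one. -/
lemma shift_down (hkL : 2 * k ≤ L) (hk : 2 ≤ k) (hJ : ∀ p, J p ≠ 0) (hq : RangeLE k q)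
    (hc : BondConserved J q) {σ : PSpec L} (hσ : q σ ≠ 0) {r : ZMod L} {v₀ w₀ : Site L}
    (hv₀ : off r v₀ = 0) (hv₀' : σ v₀ ≠ 0) (hw₀ : off r w₀ = k - 1) (hw₀' : σ w₀ ≠ 0) :
    ∃ (p pz : Bool) (u z x : Site L) (r' : ZMod L) (σ' : PSpec L),
      (off r z = 0 ∧ σ z = dl pz ∧ (∀ v, off r v = 0 → v ≠ z → σ v = 0) ∧
        σ (z + de L pz) ≠ 0) ∧
      (off r u = k - 1 ∧ σ u = dl p ∧ ∀ v, off r v = k - 1 → v ≠ u → σ v = 0) ∧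
      q σ' ≠ 0 ∧ off r' x = 0 ∧ σ' x ≠ 0 ∧ σ' (u - de L p) ≠ 0 ∧ σ' z ≠ 0 ∧
      (∀ v, off r v + 1 < L → off r' v = off r v + 1) ∧
      (∀ v, off r v + 1 < L → v ≠ u → v ≠ u - de L p → v ≠ z → σ' v = σ v) ∧
      (∀ p', σ' (u - de L p) = dl p' → p' = !p ∧ (2 < k → σ (u - de L p) = 3)) := by
  have hL : 2 ≤ L := by omega
  have hwin := hq.bound hkL hσ hv₀ hv₀' hw₀ hw₀'
  obtain ⟨p₀, hp₀⟩ := exists_dl_ne (σ w₀)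
  obtain ⟨pz, z, hz, hz', hzu, hz2, -, -⟩ := extend_top hkL hk hJ hq hc hσ hv₀ hv₀' hw₀ hw₀' hp₀
  have hznext : σ (z + de L pz) ≠ 0 := by
    have h1 := off_add_de hL (r := r) (v := z) pz (by omega)
    have h2 := off_add_de hL (r := r) (v := w₀) p₀ (by omega)
    by_cases h3 : z + de L pz = w₀
    · rwa [h3]
    · rwa [pmul_bspec_of_ne _ h3 (by intro h4; rw [h4] at h1; omega)] at hz2
  obtain ⟨p, u, hu, hu', huu, hy1, hy2, hq'⟩ := extend_bottom hkL hk hJ hq hc hσ hw₀ hw₀' hz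
    (hz' ▸ dl_ne_zero pz) (hz' ▸ dl_ne_dl_not pz)
  set x := z - de L (!pz) with hx
  have hxz : x + de L (!pz) = z := by rw [hx]; abel
  have hxoff : ¬ off r x + 1 < L := by
    intro h1
    have h2 := off_add_de hL (!pz) h1
    rw [hxz] at h2
    omega
  set τ := pmul (bspec (!pz) x) σ with hτ
  set y := u - de L p with hy
  have hyu : y + de L p = u := by rw [hy]; abel
  have hyoff : off r y = k - 2 := by
    rw [hy, off_sub_de hL _ (by omega)]; omega
  set σ' := pmul (bspec p y) τ with hσ'
  have hσx : σ x = 0 := by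
    by_contra h0
    have := hwin x h0
    omega
  have hτx : τ x = dl (!pz) := by rw [hτ, pmul_bspec_left, hσx, letter_xor_zero]
  have hτz : τ z = 3 := by
    have := pmul_bspec_right (!pz) x σ
    rw [hxz, hz', dl_not_xor_dl] at this
    exact this
  have hσ'y : σ' y = dl p ^^^ τ y := pmul_bspec_left p y τ
  have hxy : x ≠ y := by intro h; rw [h] at hxoff; omega
  have hxu : x ≠ u := by intro h; rw [h] at hxoff; omega
  have hzu' : z ≠ u := by rintro rfl; omega
  have hrx : off (x.1 + x.2) x = 0 := off_eq_zero_iff.mpr rfl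
  refine ⟨p, pz, u, z, x, x.1 + x.2, σ', ⟨hz, hz', hzu, hznext⟩, ⟨hu, hu', huu⟩, hq', hrx,
    ?_, ?_, ?_, ?_, ?_, ?_⟩
  · rw [hσ', pmul_bspec_of_ne _ hxy (by rwa [hyu]), hτx]
    exact dl_ne_zero _
  · rw [hσ'y]
    exact dl_xor_ne_zero _ _ hy2
  · by_cases hzy : z = y
    · rw [hzy, hσ'y]
      exact dl_xor_ne_zero _ _ hy2
    · rw [hσ', pmul_bspec_of_ne _ hzy (by rwa [hyu]), hτz]
      decide
  · intro v hv
    have h1 := off_add_de hL (r := x.1 + x.2) (v := x) (!pz) (by omega)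
    rw [hxz, hrx] at h1
    rw [off_rebase (a := x.1 + x.2) hz (by omega), h1]
    omega
  · intro v hv h1 h2 h3
    rw [hσ', pmul_bspec_of_ne _ h2 (by rwa [hyu]), hτ, pmul_bspec_of_ne _ _ (by rwa [hxz])]
    rintro rfl
    exact hxoff hv
  · intro p' hp'
    rw [hσ'y] at hp'
    obtain ⟨h1, h2⟩ := letter_of_xor_eq_dl _ _ _ hy1 hy2 hp'
    refine ⟨h2, fun hk2 => ?_⟩
    rwa [hτ, pmul_bspec_of_ne _ hxy.symm (by rw [hxz]; rintro h; rw [h] at hyoff; omega)] at h1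

/-- The top `i` of the `k` diagonals starting at `r` are those of a staircase. -/
def TopStair (σ : PSpec L) (r : ZMod L) (k : ℕ) (u : Site L) (T : ℤ) (i : ℕ) : Prop :=
  off r (stairSite u T) = k - 1 ∧ σ (stairSite u T) = dl (dir (T - 1)) ∧
    (∀ j : ℕ, j < i → ∀ v, off r v = k - 1 - j → v ≠ stairSite u (T - j) → σ v = 0) ∧
    ∀ j : ℕ, 0 < j → j < i → j < k - 1 → σ (stairSite u (T - j)) = 3

lemma exists_topStair (hkL : 2 * k ≤ L) (hk : 2 ≤ k) (hJ : ∀ p, J p ≠ 0) (hq : RangeLE k q)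
    (hc : BondConserved J q) {i : ℕ} (hi : 1 ≤ i) (hik : i ≤ k) {σ : PSpec L} (hσ : q σ ≠ 0)
    {r : ZMod L} {v₀ w₀ : Site L} (hv₀ : off r v₀ = 0) (hv₀' : σ v₀ ≠ 0)
    (hw₀ : off r w₀ = k - 1) (hw₀' : σ w₀ ≠ 0) : ∃ u T, TopStair σ r k u T i := by
  have hL : 2 ≤ L := by omega
  induction i, hi using Nat.le_induction generalizing σ r v₀ w₀ with
  | base =>
    obtain ⟨p, pz, u, z, x, r', σ', -, ⟨h1, h2, h3⟩, -⟩ :=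
      shift_down hkL hk hJ hq hc hσ hv₀ hv₀' hw₀ hw₀'
    obtain ⟨u₀, T, rfl, rfl⟩ := exists_stairSite_eq u p
    refine ⟨u₀, T, h1, h2, fun j hj v hv hne => ?_, fun j h4 h5 => by omega⟩
    obtain rfl : j = 0 := by omega
    exact h3 v (by simpa using hv) (by simpa using hne)
  | succ i hi ih =>
    obtain ⟨p, pz, u, z, x, r', σ', ⟨hz, hz', hzu, -⟩, ⟨hu, hu', huu⟩, hq', hx, hx', hy', hzn,
      hoff, hsame, hlet⟩ := shift_down hkL hk hJ hq hc hσ hv₀ hv₀' hw₀ hw₀'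
    set y := u - de L p with hy
    have hyoff : off r y = k - 2 := by
      rw [hy, off_sub_de hL _ (by omega)]; omega
    have hyoff' : off r' y = k - 1 := by rw [hoff y (by omega)]; omega
    obtain ⟨u₀, T, hT, hTl, hrow, hmid⟩ := ih (by omega) hq' hx hx' hyoff' hy'
    have hyT : y = stairSite u₀ T := by
      by_contra hne
      exact hy' (hrow 0 (by omega) y (by simpa using hyoff') (by simpa using hne))
    rw [← hyT] at hTl
    obtain ⟨hp, h3⟩ := hlet _ hTl
    have hpT : p = dir T := by
      have := dir_succ (T - 1)
      rw [sub_add_cancel, hp, Bool.not_not] at this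
      exact this.symm
    have huT : u = stairSite u₀ (T + 1) := by
      rw [stairSite_succ, ← hyT, ← hpT, hy]; abel
    have hsub : ∀ j : ℕ, T + 1 - ((j + 1 : ℕ) : ℤ) = T - j := fun j => by push_cast; ring
    refine ⟨u₀, T + 1, by rw [← huT, hu], ?_, fun j hj v hv hne => ?_, fun j h4 h5 h6 => ?_⟩
    · rw [← huT, hu', add_sub_cancel_right, hpT]
    · rcases Nat.eq_zero_or_pos j with rfl | hj0
      · refine huu v (by simpa using hv) ?_
        rw [huT]
        simpa using hne
      · obtain ⟨j, rfl⟩ : ∃ j', j = j' + 1 := ⟨j - 1, by omega⟩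
        rw [hsub] at hne
        have h7 := hrow j (by omega) v (by rw [hoff v (by omega)]; omega) hne
        by_cases hvz : v = z
        · exact absurd (hvz ▸ h7) hzn
        · rwa [hsame v (by omega) (by rintro rfl; omega) (by rintro rfl; exact hy' h7) hvz] at h7
    · obtain ⟨j, rfl⟩ : ∃ j', j = j' + 1 := ⟨j - 1, by omega⟩
      rw [hsub]
      rcases Nat.eq_zero_or_pos j with rfl | hj0
      · rw [Nat.cast_zero, sub_zero, ← hyT]
        exact h3 (by omega)
      · have h7 := hmid j hj0 (by omega) (by omega)
        have h8 : off r (stairSite u₀ (T - j)) = k - 2 - j := by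
          have h9 : ∀ j : ℕ, j ≤ k - 2 → off r (stairSite u₀ (T - j)) = k - 2 - j := by
            intro j
            induction j with
            | zero => intro _; simpa [← hyT] using hyoff
            | succ j ihj =>
              intro hj
              have h10 := ihj (by omega)
              have h11 := stairSite_succ u₀ (T - ((j + 1 : ℕ) : ℤ))
              have h12 : T - ((j + 1 : ℕ) : ℤ) + 1 = T - j := by push_cast; ring
              rw [h12] at h11
              rw [← sub_eq_iff_eq_add.mpr h11, off_sub_de hL _ (by omega)]
              omega
          exact h9 j (by omega)
        rwa [hsame _ (by omega) (by intro h; rw [h] at h8; omega)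
          (by intro h; rw [h] at h8; omega) (by intro h; rw [h] at h8; omega)] at h7

/-- Products of maximal diagonal length in the expansion are staircase paths. -/
lemma exists_eq_path (hkL : 2 * k ≤ L) (hk : 2 ≤ k) (hJ : ∀ p, J p ≠ 0) (hq : RangeLE k q)
    (hc : BondConserved J q) {σ : PSpec L} (hσ : q σ ≠ 0)
    {r : ZMod L} {v₀ w₀ : Site L} (hv₀ : off r v₀ = 0) (hv₀' : σ v₀ ≠ 0)
    (hw₀ : off r w₀ = k - 1) (hw₀' : σ w₀ ≠ 0) :
    ∃ u m, off r (stairSite u m) = 0 ∧ σ = path u m (k - 1) := by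
  have hL : 2 ≤ L := by omega
  obtain ⟨p, pz, -, z, -, -, -, ⟨hz, hz', hzu, hzn⟩, -⟩ :=
      shift_down hkL hk hJ hq hc hσ hv₀ hv₀' hw₀ hw₀'
  obtain ⟨u, T, hT, hTl, hrow, hmid⟩ :=
    exists_topStair hkL hk hJ hq hc (by omega) le_rfl hσ hv₀ hv₀' hw₀ hw₀'
  have hwin := hq.bound hkL hσ hv₀ hv₀' hw₀ hw₀'
  obtain ⟨m, rfl⟩ : ∃ m : ℤ, T = m + (k - 1 : ℕ) := ⟨T - (k - 1 : ℕ), by ring⟩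
  have hsub : ∀ j : ℕ, j ≤ k - 1 → m + ((k - 1 : ℕ) : ℤ) - ((k - 1 - j : ℕ) : ℤ) = m + j := by
    intro j hj
    push_cast [Nat.cast_sub hj]
    ring
  have hzm : z = stairSite u m := by
    by_contra hne
    have := hrow (k - 1) (by omega) z (by omega) (by simpa using hne)
    rw [hz'] at this
    exact dl_ne_zero _ this
  have hz1 : z + de L pz = stairSite u (m + 1) := by
    by_contra hne
    refine hzn (hrow (k - 2) (by omega) _ ?_ ?_)
    · rw [off_add_de hL _ (by omega), hz]; omega
    · have := hsub 1 (by omega)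
      rw [show k - 1 - 1 = k - 2 by omega] at this
      rw [this]
      exact_mod_cast hne
  have hpz : pz = dir m := by
    rw [stairSite_succ, ← hzm, add_right_inj] at hz1
    by_contra hne
    have h2 : dir m = !pz := by
      revert hne
      cases pz <;> cases dir m <;> simp
    rw [h2] at hz1
    exact de_ne_de hL _ hz1
  refine ⟨u, m, by rw [← hzm, hz], eq_path hL (r := r) (by omega) (by omega)
    (fun v hv => by have := hwin v hv; omega) (fun j hj v hv hne => ?_) ?_ hTl
    fun j h1 h2 => ?_⟩
  · refine hrow (k - 1 - j) (by omega) v (by omega) ?_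
    rwa [hsub j hj]
  · rw [← hzm, hz', hpz]
  · have := hmid (k - 1 - j) (by omega) (by omega) (by omega)
    rwa [hsub j (by omega)] at this

end

/-! ### Relations between staircase coefficients -/

section
variable {L : ℕ}

/-- The sign of a bond at the end of a staircase. -/
def bondSign (p : Bool) : ℤ := if p then 1 else -1

/-- The signed coupling of the `i`-th bond of a staircase. -/
noncomputable def stairCoupling (J : Bool → ℂ) (i : ℤ) : ℂ := J (dir i) * bondSign (dir i)

lemma stairCoupling_ne_zero {J : Bool → ℂ} (hJ : ∀ p, J p ≠ 0) (i : ℤ) :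
    stairCoupling J i ≠ 0 := by
  refine mul_ne_zero (hJ _) ?_
  generalize dir i = p
  cases p <;> simp [bondSign]

lemma kap_three_dl : ∀ p : Bool, kap (dl p) 3 (dl p) = bondSign p := by decide
lemma kap_dl_three : ∀ p : Bool, kap (dl p) (dl p) 3 = bondSign p := by decide

lemma exists_of_path_ne_zero {u : Site L} {m : ℤ} {n : ℕ} {v : Site L} (h : path u m n v ≠ 0) :
    ∃ j : ℕ, j ≤ n ∧ v = stairSite u (m + j) := by
  by_contra! h0
  exact h (path_eq_zero h0)

lemma path_row_unique (hL : 2 ≤ L) {u : Site L} {m : ℤ} {n : ℕ} (hn : n < L) {r : ZMod L}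
    (h : off r (stairSite u m) = 0) {v w : Site L} (hv : path u m n v ≠ 0)
    (hw : path u m n w ≠ 0) (hvw : off r v = off r w) : v = w := by
  obtain ⟨i, hi, rfl⟩ := exists_of_path_ne_zero hv
  obtain ⟨j, hj, rfl⟩ := exists_of_path_ne_zero hw
  rw [off_stairSite hL h (by omega), off_stairSite hL h (by omega)] at hvw
  rw [hvw]

variable [NeZero L] {k : ℕ} {q : PSpec L → ℂ} {J : Bool → ℂ}

omit [NeZero L] in
lemma path_stairSite_ne_zero (hL : 2 ≤ L) (u : Site L) (m : ℤ) {n j : ℕ} (hn : n < L)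
    (h1 : 1 ≤ n) (hj : j ≤ n) : path u m n (stairSite u (m + j)) ≠ 0 := by
  rcases Nat.eq_zero_or_pos j with rfl | hj0
  · rw [Nat.cast_zero, add_zero, path_bottom hL u m hn h1]
    exact dl_ne_zero _
  · rcases hj.eq_or_lt with rfl | hj1
    · rw [path_top hL u m hn h1]
      exact dl_ne_zero _
    · rw [path_interior hL u m hn hj0 hj1]
      decide

/-- The coefficients of consecutive staircase paths are proportional. -/
lemma path_shift {n : ℕ} (hn : 1 ≤ n) (hnL : 2 * (n + 1) ≤ L) (hq : RangeLE (n + 1) q)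
    (hc : BondConserved J q) (u : Site L) (m : ℤ) :
    stairCoupling J (m + n) * q (path u m n) + stairCoupling J m * q (path u (m + 1) n) = 0 := by
  have hL : 2 ≤ L := by omega
  set r := (stairSite u m).1 + (stairSite u m).2 with hr
  have h0 : off r (stairSite u m) = 0 := off_eq_zero_iff.mpr rfl
  have h1 : off r (stairSite u (m + (n + 1 : ℕ))) = n + 1 := off_stairSite hL h0 (by omega)
  set τ := path u m (n + 1) with hτ
  have hbot : τ (stairSite u m) = dl (dir m) := path_bottom hL u m (by omega) (by omega)
  have htop : τ (stairSite u (m + (n + 1 : ℕ))) = dl (dir (m + n)) := by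
    rw [hτ, path_top hL u m (by omega) (by omega), Nat.cast_succ, ← add_assoc,
      add_sub_cancel_right]
  have hwin : ∀ v, τ v ≠ 0 → off r v ≤ n + 1 := by
    intro v hv
    obtain ⟨j, hj, rfl⟩ := exists_of_path_ne_zero hv
    rwa [off_stairSite hL h0 (by omega)]
  have hbot' : τ (stairSite u m) ≠ 0 := hbot ▸ dl_ne_zero _
  have htop' : τ (stairSite u (m + (n + 1 : ℕ))) ≠ 0 := htop ▸ dl_ne_zero _
  have htop_eq : stairSite u (m + (n + 1 : ℕ)) = stairSite u (m + n) + de L (dir (m + n)) := by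
    rw [Nat.cast_succ, ← add_assoc, stairSite_succ]
  have hsum := hc τ fun ρ hρ => by
    by_contra h2
    exact hq.false_of_far hnL h2 h0 (fun h => hbot' ((hρ _).mp h)) h1
      (fun h => htop' ((hρ _).mp h))
  rw [Fintype.sum_eq_add (dir (m + n), stairSite u (m + n)) (dir m, stairSite u m)] at hsum
  · have e1 : pmul (bspec (dir (m + n)) (stairSite u (m + n))) τ = path u m n := by
      rw [hτ, path, pmul_cancel]
    have e2 : pmul (bspec (dir m) (stairSite u m)) τ = path u (m + 1) n := by
      rw [hτ, path_succ', pmul_cancel]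
    have e3 : τ (stairSite u (m + n)) = 3 := path_interior hL u m (by omega) hn (by omega)
    have e4 : τ (stairSite u (m + 1)) = 3 :=
      path_interior hL u m (j := 1) (by omega) le_rfl (by omega)
    simp only [bondTerm, e1, e2] at hsum
    rw [← htop_eq, htop, e3, ← stairSite_succ, hbot, e4, kap_three_dl, kap_dl_three] at hsum
    exact hsum
  · intro h
    have h2 := congrArg Prod.snd h
    have := off_stairSite hL h0 (j := n) (by omega)
    simp only at h2
    rw [h2] at this
    omega
  · rintro ⟨p, x⟩ ⟨hx1, hx2⟩
    by_contra hne
    have hq2 := (bondTerm_ne_zero hne).1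
    rcases bondTerm_ne_zero_edge hL (by omega) hwin h0 hbot' h1 htop' hne with
      ⟨⟨v, hv, hv'⟩, w, hw, hw'⟩ | ⟨h3, h4, -⟩ | ⟨h3, h4, -⟩
    · exact hq.false_of_far hnL hq2 hv hv' hw hw'
    · have hx' : τ x ≠ 0 := h4 ▸ dl_ne_zero p
      have hx : x = stairSite u m :=
        path_row_unique hL (by omega) h0 hx' hbot' (h3.trans h0.symm)
      rw [hx, hbot] at h4
      exact hx2 (by rw [hx, dl_injective _ _ h4])
    · have hx' : τ (x + de L p) ≠ 0 := h4 ▸ dl_ne_zero p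
      have hx : x + de L p = stairSite u (m + (n + 1 : ℕ)) :=
        path_row_unique hL (by omega) h0 hx' htop' (h3.trans h1.symm)
      rw [hx, htop] at h4
      obtain rfl := dl_injective _ _ h4
      rw [htop_eq, add_left_inj] at hx
      exact hx1 (by rw [hx])

/-! ### Staircases with a side branch -/

/-- The staircase path from `stairSite u (1 - j)`, multiplied by the bond branching off at
`stairSite u 1`. -/
def branch (u : Site L) (j n : ℕ) : PSpec L :=
  pmul (bspec true (stairSite u 1)) (path u (1 - j) n)

omit [NeZero L] in
lemma stairSite_two (u : Site L) : stairSite u 2 = stairSite u 1 + de L false :=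
  stairSite_succ u 1

omit [NeZero L] in
lemma stairSite_two_ne (hL : 2 ≤ L) (u : Site L) : stairSite u 2 ≠ stairSite u 1 + de L true := by
  rw [stairSite_two, Ne, add_right_inj]
  exact de_ne_de hL false

omit [NeZero L] in
lemma branch_one (u : Site L) (j n : ℕ) :
    branch u j n (stairSite u 1) = 1 ^^^ path u (1 - j) n (stairSite u 1) :=
  pmul_bspec_left _ _ _

omit [NeZero L] in
lemma branch_of_ne {u v : Site L} {j n : ℕ} (h1 : v ≠ stairSite u 1)
    (h2 : v ≠ stairSite u 1 + de L true) : branch u j n v = path u (1 - j) n v :=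
  pmul_bspec_of_ne _ h1 h2

omit [NeZero L] in
lemma stairSite_ne_side (hL : 2 ≤ L) {u : Site L} {i j : ℕ} (hi : i < L) (hj : j + 1 < L) :
    stairSite u (1 - j + i) ≠ stairSite u 1 + de L true := by
  intro h
  have h0 : off ((stairSite u (1 - j)).1 + (stairSite u (1 - j)).2) (stairSite u (1 - j)) = 0 :=
    off_eq_zero_iff.mpr rfl
  have h1 := off_stairSite hL h0 hi
  have h2 := off_stairSite hL h0 (j := j) (by omega)
  rw [sub_add_cancel] at h2
  have h3 := off_add_de hL true (h2 ▸ hj)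
  rw [← h, h1, h2] at h3
  subst h3
  refine stairSite_two_ne hL u ?_
  rw [← h]
  congr 1
  push_cast
  ring

omit [NeZero L] in
lemma branch_side (hL : 2 ≤ L) {u : Site L} {j n : ℕ} (hn : n < L) (hj : j + 1 < L) :
    branch u j n (stairSite u 1 + de L true) = 1 := by
  rw [branch, pmul_bspec_right, path_eq_zero, letter_xor_zero]
  · rfl
  · intro i hi h
    exact stairSite_ne_side hL (by omega) hj h.symm

omit [NeZero L] in
lemma branch_stairSite (hL : 2 ≤ L) {u : Site L} {i j n : ℕ} (hi : i < L) (hj : j + 1 < L)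
    (hij : i ≠ j) : branch u j n (stairSite u (1 - j + i)) =
      path u (1 - j) n (stairSite u (1 - j + i)) := by
  refine branch_of_ne ?_ (stairSite_ne_side hL hi hj)
  intro h
  refine hij (stairSite_injOn hL u (1 - j) hi (by omega) ?_)
  rw [h, sub_add_cancel]

/-- The bonds contributing to the coefficient of a branched staircase path. -/
lemma bond_of_bondTerm_branch_ne_zero {l : ℕ} (hlL : 2 * (l + 2) ≤ L) (hJ : ∀ p, J p ≠ 0)
    (hq : RangeLE (l + 2) q) (hc : BondConserved J q) {u : Site L} {j : ℕ} (hj : j ≤ l) :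
    (∀ σ : PSpec L, (∀ v, σ v = 0 ↔ branch u j (l + 1) v = 0) → q σ = 0) ∧
    ∀ b, bondTerm J q (branch u j (l + 1)) b ≠ 0 → b = (true, stairSite u 1) ∨
      b = (dir (1 - j), stairSite u (1 - j)) ∨ b = (dir (1 - j + l), stairSite u (1 - j + l)) := by
  have hL : 2 ≤ L := by omega
  set m : ℤ := 1 - j with hm
  set r := (stairSite u m).1 + (stairSite u m).2 with hr
  set τ := branch u j (l + 1) with hτ
  set w := stairSite u 1 + de L true with hw
  have h0 : off r (stairSite u m) = 0 := off_eq_zero_iff.mpr rfl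
  have hmj : m + j = 1 := by rw [hm]; ring
  have hmj1 : m + (j + 1 : ℕ) = 2 := by rw [hm]; push_cast; ring
  have hoff : ∀ i : ℕ, i < L → off r (stairSite u (m + i)) = i := fun i hi =>
    off_stairSite hL h0 hi
  have hoffw : off r w = j + 1 := by
    have := hoff j (by omega)
    rw [hmj] at this
    rw [hw, off_add_de hL _ (by omega), this]
  have hτw : τ w = 1 := branch_side hL (by omega) (by omega)
  have hτs : ∀ i : ℕ, i < L → i ≠ j → τ (stairSite u (m + i)) = path u m (l + 1)
      (stairSite u (m + i)) := fun i hi hij => branch_stairSite hL hi (by omega) hij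
  have hsupp : ∀ v, τ v ≠ 0 → v ≠ w → ∃ i : ℕ, i ≤ l + 1 ∧ v = stairSite u (m + i) := by
    intro v hv hvw
    by_cases h1 : v = stairSite u 1
    · exact ⟨j, by omega, by rw [hmj, h1]⟩
    · rw [hτ, branch_of_ne h1 hvw] at hv
      exact exists_of_path_ne_zero hv
  have hrow : ∀ v, τ v ≠ 0 → v ≠ w → v = stairSite u (m + off r v) ∧ off r v ≤ l + 1 := by
    intro v hv hvw
    obtain ⟨i, hi, rfl⟩ := hsupp v hv hvw
    rw [hoff i (by omega)]
    exact ⟨rfl, hi⟩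
  have hwin : ∀ v, τ v ≠ 0 → off r v ≤ l + 1 := by
    intro v hv
    by_cases hvw : v = w
    · rw [hvw, hoffw]; omega
    · exact (hrow v hv hvw).2
  have hτ1 : j = 0 → τ (stairSite u m) = 3 := by
    intro hj0
    have h1 : m = 1 := by rw [hm, hj0]; simp
    have h2 := path_bottom hL u m (n := l + 1) (by omega) (by omega)
    rw [h1] at h2 ⊢
    rw [hτ, branch_one, ← hm, h1, h2]
    rfl
  have hbot : 0 < j → τ (stairSite u m) = dl (dir m) := by
    intro hj0
    have := hτs 0 (by omega) (by omega)
    rw [Nat.cast_zero, add_zero] at this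
    rw [this, path_bottom hL u m (by omega) (by omega)]
  have hbot' : τ (stairSite u m) ≠ 0 := by
    rcases Nat.eq_zero_or_pos j with hj0 | hj0
    · rw [hτ1 hj0]; decide
    · rw [hbot hj0]; exact dl_ne_zero _
  have htop : τ (stairSite u (m + (l + 1 : ℕ))) = dl (dir (m + l)) := by
    rw [hτs _ (by omega) (by omega), path_top hL u m (by omega) (by omega), Nat.cast_succ,
      ← add_assoc, add_sub_cancel_right]
  have htop' : τ (stairSite u (m + (l + 1 : ℕ))) ≠ 0 := htop ▸ dl_ne_zero _
  have htop_eq : stairSite u (m + (l + 1 : ℕ)) = stairSite u (m + l) + de L (dir (m + l)) := by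
    rw [Nat.cast_succ, ← add_assoc, stairSite_succ]
  have hofftop := hoff (l + 1) (by omega)
  have hs2 : τ (stairSite u 2) = path u m (l + 1) (stairSite u 2) := by
    have := hτs (j + 1) (by omega) (by omega)
    rwa [hmj1] at this
  have hs2' : τ (stairSite u 2) ≠ 0 := by
    rw [hs2, ← hmj1]
    exact path_stairSite_ne_zero hL u m (by omega) (by omega) (by omega)
  have hoff2 : off r (stairSite u 2) = j + 1 := by rw [← hmj1, hoff _ (by omega)]
  have h2w : stairSite u 2 ≠ w := stairSite_two_ne hL u
  have hpair : ∀ ρ : PSpec L, q ρ ≠ 0 → ∀ v, off r v = 0 → ρ v ≠ 0 → ∀ v', off r v' = l + 1 →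
      ρ v' ≠ 0 → ρ (stairSite u 2) ≠ 0 → ρ w ≠ 0 → False := by
    intro ρ hρ v hv hv' x hx hx' h2 h3
    obtain ⟨u', m', hu', rfl⟩ :=
      exists_eq_path hlL (by omega) hJ hq hc hρ hv hv' (w₀ := x) (by omega) hx'
    exact h2w (path_row_unique hL (by omega) hu' h2 h3 (hoff2.trans hoffw.symm))
  refine ⟨fun ρ hρ => ?_, ?_⟩
  · by_contra h1
    have h2 : ∀ v, τ v ≠ 0 → ρ v ≠ 0 := fun v hv h => hv ((hρ v).mp h)
    exact hpair ρ h1 _ h0 (h2 _ hbot') _ hofftop (h2 _ htop') (h2 _ hs2')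
      (h2 _ (by rw [hτw]; decide))
  rintro ⟨p, x⟩ hne
  obtain ⟨hq2, y, z, hyz, hy, hy', hz, hrest⟩ := bondTerm_ne_zero hne
  rcases bondTerm_ne_zero_edge hL (by omega) hwin h0 hbot' hofftop htop' hne with
      ⟨⟨v, hv, hv'⟩, v₁, hv₁, hv₁'⟩ | ⟨h3, h4, -⟩ | ⟨h3, h4, h5, -⟩
  · by_cases hzw : z = w
    · left
      rw [hzw, hτw] at hz
      have hp : p = true := dl_injective _ _ (hz.resolve_left (by decide)).symm
      subst hp
      rcases hyz with ⟨rfl, h6⟩ | ⟨rfl, h6⟩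
      · rw [hzw, hw, add_left_inj] at h6
        rw [h6]
      · exfalso
        rw [hzw] at h6
        have h7 : off r y = j + 2 := by
          rw [h6, off_add_de hL _ (by omega), hoffw]
        obtain ⟨h8, -⟩ := hrow y hy (by intro h; rw [h] at h7; omega)
        rw [h7, show m + ((j + 2 : ℕ) : ℤ) = 2 + 1 by rw [hm]; push_cast; ring,
          stairSite_succ, h6] at h8
        exact h2w (add_right_cancel h8).symm
    · by_cases hz2 : z = stairSite u 2
      · right; right
        rw [hz2] at hz
        have h6 := hz.resolve_left hs2'
        rcases hj.eq_or_lt with hjl | hjl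
        · have hml : m + l = 1 := by rw [hm, hjl]; ring
          have h7 : stairSite u (m + (l + 1 : ℕ)) = stairSite u 2 := by rw [← hmj1, hjl]
          rw [h7] at htop htop_eq
          rw [htop] at h6
          obtain rfl := (dl_injective _ _ h6).symm
          rcases hyz with ⟨rfl, h8⟩ | ⟨rfl, h8⟩
          · rw [← hz2, h8, add_left_inj] at htop_eq
            rw [htop_eq]
          · exfalso
            rw [hz2] at h8
            have h9 := hwin y hy
            rw [h8, off_add_de hL _ (by omega)] at h9
            omega
        · exfalso
          rw [hs2, ← hmj1, path_interior hL u m (by omega) (by omega) (by omega)] at h6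
          exact dl_ne_three p h6.symm
      · exfalso
        exact hpair _ hq2 v hv hv' v₁ hv₁ hv₁' (hrest _ (Ne.symm hz2) hs2')
          (hrest _ (Ne.symm hzw) (by rw [hτw]; decide))
  · right; left
    have hxw : x ≠ w := by rintro rfl; omega
    have hx := (hrow x (h4 ▸ dl_ne_zero p) hxw).1
    rw [h3, Nat.cast_zero, add_zero] at hx
    rcases Nat.eq_zero_or_pos j with hj0 | hj0
    · rw [hx, hτ1 hj0] at h4
      exact (dl_ne_three p h4.symm).elim
    · rw [hx, hbot hj0] at h4
      rw [hx, dl_injective _ _ h4]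
  · right; right
    have hxw : x + de L p ≠ w := by
      intro h
      rw [h, hoffw] at h3
      exact hs2' (h5 _ (by omega) (by rwa [h]))
    have hx := (hrow _ (h4 ▸ dl_ne_zero p) hxw).1
    rw [h3] at hx
    rw [hx, htop] at h4
    obtain rfl := dl_injective _ _ h4
    rw [htop_eq, add_left_inj] at hx
    rw [hx]

end

/-! ### Vanishing of the staircase coefficients -/

section
variable {L : ℕ} [NeZero L] {q : PSpec L → ℂ} {J : Bool → ℂ}

omit [NeZero L] in
lemma branch_one_letter (hL : 2 ≤ L) {u : Site L} {j n : ℕ} (hn : n < L) (hj : j < n) :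
    branch u j n (stairSite u 1) = if j = 0 then 3 else 2 := by
  rw [branch_one]
  rcases Nat.eq_zero_or_pos j with rfl | hj0
  · have h := path_bottom hL u (1 - (0 : ℕ)) hn (by omega)
    simp only [Nat.cast_zero, sub_zero] at h ⊢
    rw [h]
    rfl
  · have h := path_interior hL u (1 - j) hn hj0 hj
    rw [sub_add_cancel] at h
    rw [h, if_neg (by omega)]
    rfl

omit [NeZero L] in
lemma bondTerm_branch_side (hL : 2 ≤ L) {u : Site L} {j n : ℕ} (hn : n + 1 < L) (hj : j < n) :
    bondTerm J q (branch u j n) (true, stairSite u 1) =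
      (if j = 0 then 1 else -1) * J true * q (path u (1 - j) n) := by
  have e : pmul (bspec true (stairSite u 1)) (branch u j n) = path u (1 - j) n := by
    rw [branch, pmul_cancel]
  simp only [bondTerm, e]
  rw [branch_side hL (by omega) (by omega), branch_one_letter hL (by omega) hj]
  split_ifs
  · rw [show kap (dl true) 3 1 = 1 by decide]
    push_cast
    ring
  · rw [show kap (dl true) 2 1 = -1 by decide]
    push_cast
    ring

omit [NeZero L] in
lemma bondTerm_branch_bottom_zero (hL : 2 ≤ L) {u : Site L} {n : ℕ} (hn : n + 2 < L)
    (h1 : 1 ≤ n) :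
    bondTerm J q (branch u 0 (n + 1)) (dir (1 - (0 : ℕ)), stairSite u (1 - (0 : ℕ))) = 0 := by
  have h2 := branch_stairSite (u := u) (i := 1) (j := 0) (n := n + 1) hL (by omega) (by omega)
    (by omega)
  rw [path_interior hL u _ (by omega) (by omega) (by omega)] at h2
  have h3 := branch_one_letter (u := u) (j := 0) (n := n + 1) hL (by omega) (by omega)
  simp only [Nat.cast_zero, sub_zero, Nat.cast_one] at h2 ⊢
  simp only [bondTerm]
  rw [← stairSite_succ, h2, h3, show kap (dl (dir 1)) (if 0 = 0 then 3 else 2) 3 = 0 by decide]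
  simp

omit [NeZero L] in
lemma bondTerm_branch_bottom (hL : 2 ≤ L) {u : Site L} {j n : ℕ} (hn : n + 2 < L) (h1 : 1 ≤ n)
    (hj : j < n) :
    bondTerm J q (branch u (j + 1) (n + 1)) (dir (1 - (j + 1 : ℕ)), stairSite u (1 - (j + 1 : ℕ)))
      = (if j = 0 then -1 else 1) * stairCoupling J (-j) * q (branch u j n) := by
  have em : 1 - ((j + 1 : ℕ) : ℤ) = -j := by push_cast; ring
  have e : pmul (bspec (dir (1 - (j + 1 : ℕ))) (stairSite u (1 - (j + 1 : ℕ))))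
      (branch u (j + 1) (n + 1)) = branch u j n := by
    rw [branch, path_succ', pmul_left_comm, pmul_cancel, branch]
    congr 2
    push_cast
    ring
  have h2 := branch_stairSite (u := u) (i := 0) (j := j + 1) (n := n + 1) hL (by omega) (by omega)
    (by omega)
  rw [Nat.cast_zero, add_zero, path_bottom hL u _ (by omega) (by omega)] at h2
  simp only [bondTerm, e]
  rw [← stairSite_succ, h2, em, stairCoupling]
  rcases Nat.eq_zero_or_pos j with rfl | hj0
  · have h3 := branch_one_letter (u := u) (j := 0 + 1) (n := n + 1) hL (by omega) (by omega)
    rw [show -((0 : ℕ) : ℤ) + 1 = 1 by simp, h3,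
      show kap (dl (dir (-((0 : ℕ) : ℤ)))) (dl (dir (-((0 : ℕ) : ℤ)))) (if 0 + 1 = 0 then 3 else 2)
        = -bondSign (dir (-((0 : ℕ) : ℤ))) by decide, if_pos rfl]
    push_cast
    ring
  · have h3 := branch_stairSite (u := u) (i := 1) (j := j + 1) (n := n + 1) hL (by omega)
      (by omega) (by omega)
    rw [path_interior hL u _ (by omega) (by omega) (by omega), em, Nat.cast_one] at h3
    rw [h3, kap_dl_three, if_neg (by omega), one_mul]

omit [NeZero L] in
lemma bondTerm_branch_top (hL : 2 ≤ L) {u : Site L} {j n : ℕ} (hn : n + 2 < L) (h1 : 1 ≤ n)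
    (hj : j ≤ n) :
    bondTerm J q (branch u j (n + 1)) (dir (1 - j + n), stairSite u (1 - j + n))
      = (if j < n then stairCoupling J (1 - j + n) else 0) * q (branch u j n) := by
  have e : pmul (bspec (dir (1 - j + n)) (stairSite u (1 - j + n)))
      (branch u j (n + 1)) = branch u j n := by
    rw [branch, path, pmul_left_comm, pmul_cancel, branch]
  have h2 := branch_stairSite (u := u) (i := n + 1) (j := j) (n := n + 1) hL (by omega) (by omega)
    (by omega)
  rw [path_top hL u _ (by omega) (by omega), Nat.cast_succ, ← add_assoc,
    add_sub_cancel_right] at h2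
  simp only [bondTerm, e]
  rw [← stairSite_succ, h2, stairCoupling]
  rcases hj.eq_or_lt with rfl | hj
  · have h3 := branch_one_letter (u := u) (j := j) (n := j + 1) hL (by omega) (by omega)
    rw [if_neg (by omega)] at h3
    rw [sub_add_cancel, h3, if_neg (by omega), show kap (dl (dir 1)) 2 (dl (dir 1)) = 0 by decide]
    simp
  · rw [branch_stairSite hL (by omega) (by omega) (by omega),
      path_interior hL u _ (by omega) (by omega) (by omega), kap_three_dl, if_pos hj]

lemma branch_sum {l : ℕ} (hl : 1 ≤ l) (hlL : 2 * (l + 2) ≤ L) (hJ : ∀ p, J p ≠ 0)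
    (hq : RangeLE (l + 2) q) (hc : BondConserved J q) (u : Site L) {j : ℕ} (hj : j ≤ l) :
    bondTerm J q (branch u j (l + 1)) (true, stairSite u 1) +
      (bondTerm J q (branch u j (l + 1)) (dir (1 - j), stairSite u (1 - j)) +
      bondTerm J q (branch u j (l + 1)) (dir (1 - j + l), stairSite u (1 - j + l))) = 0 := by
  have hL : 2 ≤ L := by omega
  obtain ⟨h1, h2⟩ := bond_of_bondTerm_branch_ne_zero hlL hJ hq hc (u := u) hj
  have hne : ∀ i : ℕ, i ≤ l → (true, stairSite u 1) ≠
      (dir (1 - j + i), stairSite u (1 - j + i)) := by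
    intro i hi h
    have h3 := congrArg Prod.snd h
    have h4 := congrArg Prod.fst h
    simp only at h3 h4
    have h5 : j = i := by
      refine stairSite_injOn hL u (1 - j) (by omega) (by omega) ?_
      rw [← h3, sub_add_cancel]
    rw [← h5, sub_add_cancel] at h4
    exact absurd h4 (by decide)
  rw [← hc _ h1, ← Finset.sum_subset (Finset.subset_univ
    {(true, stairSite u 1), (dir (1 - j), stairSite u (1 - j)),
      (dir (1 - j + l), stairSite u (1 - j + l))}), Finset.sum_insert, Finset.sum_pair]
  · intro h
    have h3 := congrArg Prod.snd h
    simp only at h3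
    have := stairSite_injOn hL u (1 - j) (i := 0) (j := l) (by omega) (by omega) (by simpa using h3)
    omega
  · have h3 := hne 0 (by omega)
    rw [Nat.cast_zero, add_zero] at h3
    simp only [Finset.mem_insert, Finset.mem_singleton, not_or]
    exact ⟨h3, hne l le_rfl⟩
  · intro b _ hb
    by_contra h0
    simp only [Finset.mem_insert, Finset.mem_singleton] at hb
    exact hb (h2 b h0)

lemma branch_induction {l : ℕ} (hl : 1 ≤ l) (hlL : 2 * (l + 2) ≤ L) (hJ : ∀ p, J p ≠ 0)
    (hq : RangeLE (l + 2) q) (hc : BondConserved J q) (u : Site L) {j : ℕ} (hj : j < l) :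
    (if j + 1 < l then stairCoupling J (-j + l) else 0) * q (branch u (j + 1) l)
      = (j + 2) * J true * q (path u (-j) (l + 1)) := by
  have hL : 2 ≤ L := by omega
  have em : ∀ j : ℕ, 1 - ((j + 1 : ℕ) : ℤ) = -j := fun j => by push_cast; ring
  have key : ∀ j : ℕ, j < l → -(J true * q (path u (-j) (l + 1)))
      + (if j = 0 then -1 else 1) * stairCoupling J (-j) * q (branch u j l)
      + (if j + 1 < l then stairCoupling J (-j + l) else 0) * q (branch u (j + 1) l) = 0 := by
    intro j hj
    have h := branch_sum hl hlL hJ hq hc u (j := j + 1) hj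
    rw [bondTerm_branch_side hL (by omega) (by omega),
      bondTerm_branch_top hL (by omega) hl (by omega : j + 1 ≤ l),
      bondTerm_branch_bottom hL (by omega) hl hj, if_neg (by omega), em] at h
    linear_combination h
  have shift : ∀ j : ℕ, stairCoupling J (1 - j + l) * q (path u (-j) (l + 1))
      + stairCoupling J (-j) * q (path u (1 - j) (l + 1)) = 0 := by
    intro j
    have h := path_shift (by omega) hlL hq hc u (-j)
    rwa [show -(j : ℤ) + (l + 1 : ℕ) = 1 - j + l by push_cast; ring,
      show -(j : ℤ) + 1 = 1 - j by ring] at h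
  induction j with
  | zero =>
    have h := branch_sum hl hlL hJ hq hc u (j := 0) (by omega)
    rw [bondTerm_branch_side hL (by omega) (by omega), bondTerm_branch_top hL (by omega) hl hj.le,
      bondTerm_branch_bottom_zero hL (by omega) hl, if_pos rfl, if_pos hj] at h
    have h1 := key 0 hj
    have h2 := shift 0
    have e : stairCoupling J (-((0 : ℕ) : ℤ)) = J true := by
      rw [Nat.cast_zero, neg_zero, stairCoupling]
      simp [dir, bondSign]
    have h4 := stairCoupling_ne_zero hJ (1 - (0 : ℕ) + l)
    rw [e] at h1 h2
    rw [if_pos rfl] at h1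
    have h3 : q (branch u 0 l) = q (path u (-(0 : ℕ)) (l + 1)) := by
      refine mul_left_cancel₀ h4 ?_
      linear_combination h - h2
    rw [h3] at h1
    push_cast at h1 ⊢
    linear_combination h1
  | succ j ih =>
    have h1 := key (j + 1) hj
    have h2 := ih (by omega)
    have h3 := shift (j + 1)
    have h4 := stairCoupling_ne_zero hJ (-j + l)
    rw [if_pos hj] at h2
    rw [if_neg (by omega)] at h1
    rw [em] at h3
    refine mul_left_cancel₀ h4 ?_
    push_cast at h1 h2 h3 ⊢
    linear_combination stairCoupling J (-j + l) * h1 - stairCoupling J (-(j + 1)) * h2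
      - (j + 2) * J true * h3

/-- Staircase paths with at least two bonds do not contribute. -/
lemma path_coeff_eq_zero {l : ℕ} (hl : 1 ≤ l) (hlL : 2 * (l + 2) ≤ L) (hJ : ∀ p, J p ≠ 0)
    (hq : RangeLE (l + 2) q) (hc : BondConserved J q) (u : Site L) (m : ℤ) :
    q (path u m (l + 1)) = 0 := by
  have h0 := branch_induction hl hlL hJ hq hc u (j := l - 1) (by omega)
  rw [if_neg (by omega), zero_mul, eq_comm] at h0
  have h1 : q (path u (-(l - 1 : ℕ)) (l + 1)) = 0 := by
    refine (mul_eq_zero.mp h0).resolve_left (mul_ne_zero ?_ (hJ true))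
    exact_mod_cast (by omega : l - 1 + 2 ≠ 0)
  have hs := path_shift (by omega) hlL hq hc u
  induction m using Int.inductionOn' (b := -(l - 1 : ℕ)) with
  | zero => exact h1
  | succ m _ ih =>
    have h := hs m
    rw [ih, mul_zero, zero_add] at h
    exact (mul_eq_zero.mp h).resolve_left (stairCoupling_ne_zero hJ _)
  | pred m _ ih =>
    have h := hs (m - 1)
    rw [sub_add_cancel, ih, mul_zero, add_zero] at h
    exact (mul_eq_zero.mp h).resolve_left (stairCoupling_ne_zero hJ _)

end

/-! ### Nearest-neighbour and on-site products -/

section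
variable {L : ℕ}

lemma stairSite_zero (u : Site L) : stairSite u 0 = u := by
  simp [stairSite]

lemma path_one (u : Site L) (m : ℤ) : path u m 1 = bspec (dir m) (stairSite u m) := by
  rw [path_succ', path]
  funext v
  exact letter_xor_zero _

variable [NeZero L] {k : ℕ} {q : PSpec L → ℂ} {J : Bool → ℂ}

/-- If no product spans exactly `k` diagonals then all products fit in `k - 1` diagonals. -/
lemma RangeLE.pred (hk : 2 ≤ k) (hkL : k ≤ L) (hq : RangeLE k q)
    (h : ∀ σ : PSpec L, q σ ≠ 0 → ∀ r v w, off r v = 0 → σ v ≠ 0 → off r w = k - 1 →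
      σ w ≠ 0 → False) : RangeLE (k - 1) q := by
  intro σ hσ
  obtain ⟨a, ha⟩ := hq σ hσ
  have ha' : ∀ v, σ v ≠ 0 → off a v < k := ha
  by_cases h0 : ∃ v, off a v = 0 ∧ σ v ≠ 0
  · obtain ⟨v, hv, hv'⟩ := h0
    refine ⟨a, fun w hw => ?_⟩
    change off a w < k - 1
    have h1 := ha' w hw
    by_contra h2
    exact h σ hσ a v w hv hv' (by omega) hw
  · push Not at h0
    refine ⟨a + 1, fun w hw => ?_⟩
    have h1 := ha' w hw
    have h2 : off a w ≠ 0 := fun h2 => hw (h0 w h2)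
    have h3 : w.1 + w.2 - (a + 1) = ((off a w - 1 : ℕ) : ZMod L) := by
      rw [Nat.cast_sub (by omega), off, ZMod.natCast_zmod_val]
      push_cast
      ring
    rw [h3, ZMod.val_natCast_of_lt (by omega)]
    omega

lemma RangeLE.pred_of_path (hk : 2 ≤ k) (hkL : 2 * k ≤ L) (hJ : ∀ p, J p ≠ 0)
    (hq : RangeLE k q) (hc : BondConserved J q) (h : ∀ u m, q (path u m (k - 1)) = 0) :
    RangeLE (k - 1) q := by
  refine hq.pred hk (by omega) fun σ hσ r v w hv hv' hw hw' => ?_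
  obtain ⟨u, m, -, rfl⟩ := exists_eq_path hkL hk hJ hq hc hσ hv hv' hw hw'
  exact hσ (h u m)

/-- The two bonds leaving a site have proportional coefficients. -/
lemma bond_proportional (hL : 4 ≤ L) (hJ : ∀ p, J p ≠ 0) (hq : RangeLE 2 q)
    (hc : BondConserved J q) (x : Site L) :
    J true * q (bspec false x) = J false * q (bspec true x) := by
  obtain ⟨u, rfl⟩ : ∃ u, stairSite u 1 = x := by
    refine ⟨x - de L true, ?_⟩
    have h := stairSite_succ (x - de L true) 0
    rwa [stairSite_zero, show dir 0 = true by decide, sub_add_cancel] at h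
  obtain ⟨h1, h2⟩ := bond_of_bondTerm_branch_ne_zero (l := 0) hL hJ hq hc (u := u) (j := 0) le_rfl
  have hsum := hc _ h1
  simp only [Nat.cast_zero, sub_zero, add_zero, or_self, zero_add,
    show dir 1 = false by decide] at h2 hsum
  rw [Fintype.sum_eq_add (true, stairSite u 1) (false, stairSite u 1) (by simp)
    (fun b hb => by
      by_contra h0
      rcases h2 b h0 with h3 | h3
      · exact hb.1 h3
      · exact hb.2 h3), bondTerm_branch_side (by omega) (by omega) (by omega), if_pos rfl] at hsum
  have e1 : path u (1 - (0 : ℕ)) 1 = bspec false (stairSite u 1) := path_one u 1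
  have e2 : pmul (bspec false (stairSite u 1)) (branch u 0 1) = bspec true (stairSite u 1) := by
    rw [branch, e1, pmul_comm (bspec true _), pmul_cancel]
  have e3 := branch_one_letter (u := u) (j := 0) (n := 1) (by omega) (by omega) (by omega)
  have e4 : branch u 0 1 (stairSite u 1 + de L false) = 2 := by
    rw [← stairSite_two, branch_of_ne, e1, stairSite_two, bspec_right]
    · rfl
    · rw [stairSite_two]
      exact add_de_ne (by omega) _ _
    · exact stairSite_two_ne (by omega) u
  rw [if_pos rfl] at e3
  simp only [bondTerm, e1, e2, e3, e4] at hsum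
  rw [show kap (dl false) 3 2 = -1 by decide] at hsum
  push_cast at hsum
  linear_combination hsum

lemma bond_shift_eq_zero (hL : 4 ≤ L) (hJ : ∀ p, J p ≠ 0) (hq : RangeLE 2 q)
    (hc : BondConserved J q) {p : Bool} {x : Site L} (h : q (bspec p x) = 0) :
    q (bspec (!p) (x + de L p)) = 0 := by
  obtain ⟨u, m, rfl, hm⟩ := exists_stairSite_eq x (!p)
  have hp : dir m = p := by
    have := dir_succ (m - 1)
    rwa [sub_add_cancel, hm, Bool.not_not] at this
  subst hp
  have h1 := path_shift (n := 1) le_rfl (by omega) hq hc u m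
  rw [path_one, path_one, h, mul_zero, zero_add, dir_succ, stairSite_succ] at h1
  exact (mul_eq_zero.mp h1).resolve_left (stairCoupling_ne_zero hJ _)

lemma bond_eq_zero (hL : 4 ≤ L) (hJ : ∀ p, J p ≠ 0) (hq : RangeLE 2 q)
    (hc : BondConserved J q) (h : q (bspec true 0) = 0) (p : Bool) (x : Site L) :
    q (bspec p x) = 0 := by
  have hall : ∀ (p : Bool) (x : Site L), q (bspec p x) = 0 → ∀ p', q (bspec p' x) = 0 := by
    intro p x hx p'
    have h1 := bond_proportional hL hJ hq hc x
    cases p <;> cases p'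
    · exact hx
    · rw [hx, mul_zero, eq_comm] at h1
      exact (mul_eq_zero.mp h1).resolve_left (hJ _)
    · rw [hx, mul_zero] at h1
      exact (mul_eq_zero.mp h1).resolve_left (hJ _)
    · exact hx
  have hstep : ∀ (p : Bool) (x : Site L), (∀ p', q (bspec p' x) = 0) →
      ∀ p', q (bspec p' (x + de L p)) = 0 := fun p x hx =>
    hall _ _ (bond_shift_eq_zero hL hJ hq hc (hx p))
  have hnat : ∀ a b : ℕ, ∀ p, q (bspec p ((a : ZMod L), (b : ZMod L))) = 0 := by
    intro a b
    induction b with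
    | zero =>
      induction a with
      | zero =>
        intro p
        rw [Nat.cast_zero]
        exact hall _ _ h p
      | succ a ih => simpa [de] using hstep true _ ih
    | succ b ih => simpa [de] using hstep false _ ih
  have := hnat x.1.val x.2.val p
  rwa [ZMod.natCast_zmod_val, ZMod.natCast_zmod_val] at this

omit [NeZero L] in
lemma de_add_de_ne_zero (hL : 2 ≤ L) (p : Bool) : de L p + de L (!p) ≠ 0 := by
  have h := one_ne_zero_of_two_le hL
  cases p <;> simp [de, Prod.ext_iff, h]

lemma de_two_add_de_two : ∀ p : Bool, de 2 p + de 2 p = 0 := by decide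

/-- On-site operators and their products along a diagonal do not contribute. -/
lemma eq_zero_of_rangeLE_one (hL : 2 ≤ L) (hJ : ∀ p, J p ≠ 0) (hq : RangeLE 1 q)
    (hc : BondConserved J q) {σ : PSpec L} (hσ0 : σ ≠ 0) : q σ = 0 := by
  by_contra hσ
  obtain ⟨u, hu⟩ := Function.ne_iff.mp hσ0
  obtain ⟨p, hp⟩ := exists_dl_ne (σ u)
  set r := u.1 + u.2 with hr
  have h0 : off r u = 0 := off_eq_zero_iff.mpr rfl
  have h1 : off r (u + de L p) = 1 := by rw [off_add_de hL p (by omega), h0]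
  have hwin := hq.bound hL hσ h0 hu h0 hu
  have hux : u + de L p ≠ u := add_de_ne hL p u
  set τ := pmul (bspec p u) σ with hτ
  have hτu : τ u = dl p ^^^ σ u := pmul_bspec_left p u σ
  have hτu' : τ u ≠ 0 := by rw [hτu]; exact dl_xor_ne_zero p _ hp
  have hτx : τ (u + de L p) = dl p := by
    rw [hτ, pmul_bspec_right]
    have : σ (u + de L p) = 0 := by
      by_contra h2
      have := hwin _ h2
      omega
    rw [this, letter_xor_zero]
  have hτx' : τ (u + de L p) ≠ 0 := hτx ▸ dl_ne_zero p
  have hsupp : ∀ v, τ v ≠ 0 → v ≠ u + de L p → off r v = 0 := by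
    intro v hv hvx
    by_cases hvu : v = u
    · rw [hvu, h0]
    · rw [hτ, pmul_bspec_of_ne _ hvu hvx] at hv
      have := hwin v hv
      omega
  have hsum := hc τ fun ρ hρ => by
    by_contra h2
    exact hq.false_of_far hL h2 h0 (fun h => hτu' ((hρ _).mp h)) h1
      (fun h => hτx' ((hρ _).mp h))
  have hmain : bondTerm J q τ (p, u) ≠ 0 := by
    simp only [bondTerm, hτu, hτx]
    refine mul_ne_zero (mul_ne_zero (hJ p) ?_) ?_
    · exact_mod_cast kap_left_ne_zero p _ hu hp
    · rwa [hτ, pmul_cancel]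
  have hall : ∀ b, bondTerm J q τ b ≠ 0 → bondTerm J q τ b = bondTerm J q τ (p, u) := by
    rintro ⟨p', x⟩ hne
    obtain ⟨hq2, y, z, hyz, hy, hy', hz, hrest⟩ := bondTerm_ne_zero hne
    by_cases hzu : z = u
    · exfalso
      subst hzu
      by_cases hyx : y = z + de L p
      · by_cases hpp : p' = p
        · subst hpp
          rw [hyx] at hy'
          exact hy' hτx
        · obtain rfl : p' = !p := by
            revert hpp
            cases p <;> cases p' <;> simp
          rcases hyz with ⟨rfl, h2⟩ | ⟨rfl, h2⟩
          · rw [hyx, add_assoc, left_eq_add] at h2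
            exact de_add_de_ne_zero hL p h2
          · rw [hyx, add_right_inj] at h2
            exact de_ne_de hL p h2
      · have h2 := hsupp y hy hyx
        rcases hyz with ⟨rfl, h3⟩ | ⟨rfl, h3⟩
        · have h4 := off_add_de hL (r := r) (v := y) p' (by omega)
          rw [← h3] at h4
          omega
        · have h4 := off_add_de hL (r := r) (v := z) p' (by omega)
          rw [← h3] at h4
          omega
    · by_cases hzx : z = u + de L p
      · rw [hzx, hτx] at hz
        obtain rfl := dl_injective _ _ (hz.resolve_left (dl_ne_zero p))
        rcases hyz with ⟨rfl, h2⟩ | ⟨rfl, h2⟩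
        · rw [hzx, add_left_inj] at h2
          rw [h2]
        · have hyz : y ≠ u + de L p := by
            rw [h2, hzx]
            exact add_de_ne hL p _
          have h3 := hsupp y hy hyz
          rcases hL.eq_or_lt with rfl | hL3
          · have hzu2 : z + de 2 p = u := by
              rw [hzx, add_assoc, de_two_add_de_two, add_zero]
            have hb : bspec p z = bspec p u := by
              funext v
              simp only [bspec, hzu2, ← hzx]
              split_ifs <;> rfl
            simp only [bondTerm, hb, hzu2, ← hzx]
            rw [kap_comm _ _ _ (dl_ne_zero p)]
          · exfalso
            have h4 := off_add_de hL (r := r) (v := z) p (by rw [hzx]; omega)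
            rw [← h2, h3, hzx] at h4
            omega
      · exact (hq.false_of_far hL hq2 h0 (hrest u (Ne.symm hzu) hτu') h1
          (hrest _ (Ne.symm hzx) hτx')).elim
  rw [← Finset.sum_filter_ne_zero,
    Finset.sum_congr rfl fun b hb => hall b (Finset.mem_filter.mp hb).2, Finset.sum_const,
    smul_eq_zero, Finset.card_eq_zero] at hsum
  have hmem : (p, u) ∈ Finset.univ.filter fun b => bondTerm J q τ b ≠ 0 := by simp [hmain]
  rcases hsum with h2 | h2
  · rw [h2] at hmem
    simp at hmem
  · exact hmain h2

/-! ### The Hamiltonian as an expansion -/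

/-- The coefficients of the Hamiltonian. -/
noncomputable def fieldCoeff (L : ℕ) [NeZero L] (Jx Jy hx hy hz : ℝ) (σ : PSpec L) : ℂ :=
  -∑ u : Site L, ((Jx : ℂ) * (if σ = sigXX L u then 1 else 0)
    + (Jy : ℂ) * (if σ = sigYY L u then 1 else 0) + (hx : ℂ) * (if σ = sigX L u then 1 else 0)
    + (hy : ℂ) * (if σ = sigY L u then 1 else 0) + (hz : ℂ) * (if σ = sigZ L u then 1 else 0))

lemma PauliOp_eq_Qop (ρ : PSpec L) : PauliOp L ρ = Qop L fun σ => if σ = ρ then 1 else 0 := by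
  rw [Qop, Finset.sum_eq_single ρ]
  · simp
  · intro σ _ h
    simp [h]
  · simp

lemma Qop_neg (f : PSpec L → ℂ) : -Qop L f = Qop L fun τ => -f τ := by
  simp only [Qop, neg_smul, Finset.sum_neg_distrib]

lemma Hfield_eq_Qop (Jx Jy hx hy hz : ℝ) :
    Hfield L Jx Jy hx hy hz = Qop L (fieldCoeff L Jx Jy hx hy hz) := by
  simp only [Hfield, PauliOp_eq_Qop, Qop_smul, Qop_add, Qop_sum, Qop_neg]
  rfl

lemma rangeLE_fieldCoeff (hL : 2 ≤ L) (Jx Jy hx hy hz : ℝ) :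
    RangeLE 2 (fieldCoeff L Jx Jy hx hy hz) := by
  intro σ hσ
  have hb : ∀ p u, ∃ a, DiagBoundAt L (bspec p u) a 2 := by
    intro p u
    refine ⟨u.1 + u.2, fun v hv => ?_⟩
    have h0 : off (u.1 + u.2) u = 0 := off_eq_zero_iff.mpr rfl
    change off (u.1 + u.2) v < 2
    by_cases h1 : v = u
    · rw [h1, h0]; omega
    · by_cases h2 : v = u + de L p
      · rw [h2, off_add_de hL p (by omega), h0]; omega
      · exact absurd (bspec_apply_of_ne h1 h2) hv
  have hs : ∀ w u, ∃ a, DiagBoundAt L (sigW L u w) a 2 := by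
    intro w u
    refine ⟨u.1 + u.2, fun v hv => ?_⟩
    have h0 : off (u.1 + u.2) u = 0 := off_eq_zero_iff.mpr rfl
    change off (u.1 + u.2) v < 2
    obtain rfl : v = u := by
      by_contra h1
      exact hv (if_neg h1)
    omega
  by_contra hn
  refine hσ ?_
  have h : ∀ ρ : PSpec L, (∃ a, DiagBoundAt L ρ a 2) → σ ≠ ρ := by
    rintro ρ hρ rfl
    exact hn hρ
  rw [fieldCoeff, neg_eq_zero]
  refine Finset.sum_eq_zero fun u _ => ?_
  rw [if_neg (h (sigXX L u) (hb true u)), if_neg (h (sigYY L u) (hb false u)),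
    if_neg (h (sigX L u) (hs 1 u)), if_neg (h (sigY L u) (hs 2 u)), if_neg (h (sigZ L u) (hs 3 u))]
  simp

lemma fieldCoeff_bond (hL : 3 ≤ L) (Jx Jy hx hy hz : ℝ) :
    fieldCoeff L Jx Jy hx hy hz (bspec true 0) = -Jx := by
  have h1 : (1 : ZMod L) ≠ 0 := one_ne_zero_of_two_le (by omega)
  have h2 : (1 + 1 : ZMod L) ≠ 0 := by
    intro h
    have h3 := ZMod.val_natCast_of_lt (n := L) (a := 2) (by omega)
    rw [show ((2 : ℕ) : ZMod L) = 1 + 1 by push_cast; norm_num, h] at h3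
    simp at h3
  have e0 : (bspec true 0 : PSpec L) 0 = 1 := bspec_left true 0
  have e1 : (bspec true 0 : PSpec L) (de L true) = 1 := by
    simpa [dl] using bspec_right true (0 : Site L)
  have hY : ∀ u, (bspec true 0 : PSpec L) ≠ sigYY L u := by
    intro u h
    have h3 := congrFun h 0
    rw [e0, sigYY] at h3
    split_ifs at h3 <;> exact absurd h3 (by decide)
  have hW : ∀ u w, (bspec true 0 : PSpec L) ≠ sigW L u w := by
    intro u w h
    have h3 := congrFun h 0
    have h4 := congrFun h (de L true)
    rw [e0, sigW] at h3
    rw [e1, sigW] at h4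
    split_ifs at h3 h4 with h5 h6
    · exact h1 (congrArg Prod.fst (h6.trans h5.symm))
    · exact absurd h4 (by decide)
    · exact absurd h3 (by decide)
    · exact absurd h3 (by decide)
  have hX : ∀ u, (bspec true 0 : PSpec L) = sigXX L u → u = 0 := by
    intro u h
    have h3 := congrFun h 0
    have h4 := congrFun h (de L true)
    rw [e0, sigXX] at h3
    rw [e1, sigXX] at h4
    by_contra hu
    rw [if_neg (Ne.symm hu)] at h3
    have h6 : (0 : Site L) = u + (1, 0) := by
      by_contra h6
      rw [if_neg h6] at h3
      exact absurd h3 (by decide)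
    split_ifs at h4 with h7 h8
    · rw [← h7] at h6
      exact h2 (congrArg Prod.fst h6).symm
    · exact h1 (congrArg Prod.fst (h8.trans h6.symm))
    · exact absurd h4 (by decide)
  have hx' : ∀ u, (bspec true 0 : PSpec L) ≠ sigX L u := fun u => hW u 1
  have hy' : ∀ u, (bspec true 0 : PSpec L) ≠ sigY L u := fun u => hW u 2
  have hz' : ∀ u, (bspec true 0 : PSpec L) ≠ sigZ L u := fun u => hW u 3
  have h0 : (bspec true 0 : PSpec L) = sigXX L 0 := rfl
  rw [fieldCoeff, Finset.sum_eq_single 0]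
  · rw [if_pos h0, if_neg (hY _), if_neg (hx' _), if_neg (hy' _), if_neg (hz' _)]
    simp
  · intro u _ hu
    rw [if_neg (fun h => hu (hX u h)), if_neg (hY _), if_neg (hx' _), if_neg (hy' _),
      if_neg (hz' _)]
    simp
  · simp

end

/-! ### Diagonal length -/

section
variable {L : ℕ} [NeZero L]

omit [NeZero L] in
lemma DiagBoundAt.diag_le {σ : PSpec L} {a : ZMod L} {k : ℕ} (h : DiagBoundAt L σ a k) :
    Diag L σ ≤ k :=
  Nat.sInf_le ⟨a, h⟩

lemma exists_diagBoundAt {σ : PSpec L} {k : ℕ} (h : Diag L σ ≤ k) :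
    ∃ a, DiagBoundAt L σ a k := by
  have hne : {k | ∃ a : ZMod L, DiagBoundAt L σ a k}.Nonempty :=
    ⟨L, 0, fun u _ => ZMod.val_lt _⟩
  obtain ⟨a, ha⟩ := Nat.sInf_mem hne
  exact ⟨a, fun u hu => (ha u hu).trans_le h⟩

end

lemma coupling_ne_zero {Jx Jy : ℝ} (hJx : Jx ≠ 0) (hJy : Jy ≠ 0) (p : Bool) :
    coupling Jx Jy p ≠ 0 := by
  cases p <;> simpa [coupling]

/-- For the compass model with an arbitrary uniform magnetic
field (`Jx ≠ 0`, `Jy ≠ 0`), and any `1 ≤ k̄ ≤ L/2`, the only local conserved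
quantities with diagonal length `k̄` are constant multiples of `H′`
(up to a multiple of the identity). -/
theorem compass_field_no_nontrivial_local_conserved_quantities
    (L : ℕ) [NeZero L] (Jx Jy hx hy hz : ℝ) (hJx : Jx ≠ 0) (hJy : Jy ≠ 0)
    (k : ℕ) (hk1 : 1 ≤ k) (hkL : 2 * k ≤ L)
    (q : PSpec L → ℂ)
    (hsupp : ∀ σ : PSpec L, q σ ≠ 0 → Diag L σ ≤ k)
    (hmax : ∃ σ : PSpec L, σ ≠ 0 ∧ Diag L σ = k ∧ q σ ≠ 0)
    (hcons : opComm L (Hfield L Jx Jy hx hy hz) (Qop L q) = 0) :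
    ∃ c c₀ : ℂ, c ≠ 0 ∧
      Qop L q = c • Hfield L Jx Jy hx hy hz + c₀ • (1 : Op L) := by
  have hJ := coupling_ne_zero hJx hJy
  have hq : RangeLE k q := fun σ hσ => exists_diagBoundAt (hsupp σ hσ)
  obtain ⟨σ, hσ0, hσk, hσq⟩ := hmax
  have hc := bondConserved_of_opComm (by omega) hcons
  have hnot : ¬ RangeLE (k - 1) q := fun h => by
    obtain ⟨a, ha⟩ := h σ hσq
    have := ha.diag_le
    omega
  obtain rfl | rfl | hk3 : k = 1 ∨ k = 2 ∨ 3 ≤ k := by omega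
  · exact absurd (eq_zero_of_rangeLE_one (by omega) hJ hq hc hσ0) hσq
  · set f := fieldCoeff L Jx Jy hx hy hz with hf
    have hf0 : f (bspec true 0) ≠ 0 := by
      rw [hf, fieldCoeff_bond (by omega)]
      exact neg_ne_zero.mpr (Complex.ofReal_ne_zero.mpr hJx)
    set c := q (bspec true 0) / f (bspec true 0) with hcdef
    set q' : PSpec L → ℂ := fun τ => q τ + -c * f τ with hq'
    have hQ : Qop L q' = Qop L q + -c • Hfield L Jx Jy hx hy hz := by
      rw [Hfield_eq_Qop, Qop_smul, Qop_add]
    have hcons' : opComm L (Hfield L Jx Jy hx hy hz) (Qop L q') = 0 := by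
      rw [hQ, ← hcons]
      simp only [opComm, mul_add, add_mul, Matrix.mul_smul, Matrix.smul_mul]
      abel
    have hc' := bondConserved_of_opComm (by omega) hcons'
    have hqR : RangeLE 2 q' := by
      intro τ hτ
      by_cases h : q τ = 0
      · refine rangeLE_fieldCoeff (by omega) Jx Jy hx hy hz τ fun h2 => hτ ?_
        simp only [hq', h, hf, h2, mul_zero, add_zero]
      · exact hq τ h
    have hb := bond_eq_zero hkL hJ hqR hc' (by
      simp only [hq', hcdef]
      field_simp
      ring)
    have h1 : RangeLE 1 q' := hqR.pred_of_path le_rfl hkL hJ hc' fun u m => by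
      rw [path_one]
      exact hb _ _
    have h0 : ∀ τ, τ ≠ 0 → q' τ = 0 := fun τ hτ =>
      eq_zero_of_rangeLE_one (by omega) hJ h1 hc' hτ
    have hQ0 : Qop L q' = q' 0 • (1 : Op L) := by
      rw [Qop, Finset.sum_eq_single 0 (fun τ _ hτ => by rw [h0 τ hτ, zero_smul]) (by simp),
        PauliOp_zero]
    refine ⟨c, q' 0, fun hc0 => hσq ?_, ?_⟩
    · have := h0 σ hσ0
      simpa only [hq', hc0, neg_zero, zero_mul, add_zero] using this
    · rw [← hQ0, hQ, neg_smul]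
      abel
  · obtain ⟨l, rfl⟩ : ∃ l, k = l + 2 := ⟨k - 2, by omega⟩
    exact absurd (hq.pred_of_path (by omega) hkL hJ hc fun u m =>
      path_coeff_eq_zero (by omega) hkL hJ hq hc u m) hnot
end

section
/- There are no local conserved quantities of the quantum compass Hamiltonian H with diagonal length k̄ = 1; that is, if Q = Σ_{A∈P_Λ, Diag A ≤ 1} q_A A satisfies [H,Q] = 0, then q_A = 0 for every Pauli product A with Diag A = 1. -/
open Complex Matrix

/-- The two-site Pauli product with letter `p` at `u` and at `u + d`. -/
def bond (L : ℕ) (d : Site L) (p : Fin 4) (u : Site L) : PSpec L :=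
  fun v => if v = u then p else if v = u + d then p else 0

/-- The trace of a product of three Pauli matrices. -/
noncomputable def pauliTrace (i j k : Fin 4) : ℂ :=
  Matrix.trace (pauli i * pauli j * pauli k)

lemma pauliTrace_eq_zero {i j k : Fin 4} (h : k ≠ i ^^^ j) : pauliTrace i j k = 0 := by
  revert h
  fin_cases i <;> fin_cases j <;> fin_cases k <;>
    first
      | (intro h; exact absurd (by decide) h)
      | (intro _
         simp [pauliTrace, pauli, Matrix.trace, Fin.sum_univ_two])

lemma pauliTrace_ne_zero {i j k : Fin 4} (h : k = i ^^^ j) : pauliTrace i j k ≠ 0 := by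
  subst h
  fin_cases i <;> fin_cases j <;>
    simp [pauliTrace, pauli, Matrix.trace, Fin.sum_univ_two]

lemma pauliTrace_comm {i j k : Fin 4} (h : i = 0 ∨ j = 0 ∨ k = 0) :
    pauliTrace i j k = pauliTrace i k j := by
  have h0 : pauli 0 = 1 := by simp [pauli]
  rcases h with rfl | rfl | rfl
  · simp [pauliTrace, h0, Matrix.trace_mul_comm (pauli j)]
  · simp [pauliTrace, h0]
  · simp [pauliTrace, h0]

lemma pauliTrace_anticomm {i j k : Fin 4} (hi : i ≠ 0) (hj : j ≠ 0) (hk : k ≠ 0)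
    (h : k = i ^^^ j) : pauliTrace i k j = -pauliTrace i j k := by
  subst h
  revert hi hj hk
  fin_cases i <;> fin_cases j <;>
    first
      | (intro hi hj hk
         first
          | exact absurd (by decide) hi
          | exact absurd (by decide) hj
          | exact absurd (by decide) hk)
      | (intro _ _ _
         simp [pauliTrace, pauli, Matrix.trace, Fin.sum_univ_two])

lemma trace_PauliOp_mul_mul (L : ℕ) [NeZero L] (τ β ρ : PSpec L) :
    Matrix.trace (PauliOp L τ * PauliOp L β * PauliOp L ρ) =
      ∏ w, pauliTrace (τ w) (β w) (ρ w) := by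
  have hmul : ∀ f g : Site L → Matrix (Fin 2) (Fin 2) ℂ,
      (Matrix.of fun s t : Site L → Fin 2 => ∏ u, f u (s u) (t u)) *
        (Matrix.of fun s t => ∏ u, g u (s u) (t u)) =
      Matrix.of fun s t => ∏ u, (f u * g u) (s u) (t u) := by
    intro f g
    ext s t
    simp only [Matrix.mul_apply, Matrix.of_apply, ← Finset.prod_mul_distrib]
    rw [Finset.prod_univ_sum, Fintype.piFinset_univ]
  have hP : ∀ σ : PSpec L, PauliOp L σ =
      Matrix.of fun s t : Site L → Fin 2 => ∏ u, pauli (σ u) (s u) (t u) := fun _ => rfl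
  rw [hP, hP, hP, hmul, hmul]
  simp only [Matrix.trace, Matrix.diag, Matrix.of_apply, pauliTrace]
  rw [Finset.prod_univ_sum, Fintype.piFinset_univ]

/-- The trace of `τ [β, ρ]`. -/
noncomputable def commCoeff (L : ℕ) [NeZero L] (τ β ρ : PSpec L) : ℂ :=
  ∏ w, pauliTrace (τ w) (β w) (ρ w) - ∏ w, pauliTrace (τ w) (ρ w) (β w)

lemma trace_PauliOp_mul_opComm (L : ℕ) [NeZero L] (τ β ρ : PSpec L) :
    Matrix.trace (PauliOp L τ * opComm L (PauliOp L β) (PauliOp L ρ)) = commCoeff L τ β ρ := by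
  rw [commCoeff, opComm, mul_sub, Matrix.trace_sub, ← mul_assoc, ← mul_assoc,
    trace_PauliOp_mul_mul, trace_PauliOp_mul_mul]

lemma eq_xor_comm (i j k : Fin 4) : k = i ^^^ j ↔ j = i ^^^ k := by
  revert i j k; decide

lemma eq_xor_of_commCoeff_ne_zero {L : ℕ} [NeZero L] {τ β ρ : PSpec L}
    (h : commCoeff L τ β ρ ≠ 0) (w : Site L) : ρ w = τ w ^^^ β w := by
  by_contra hw
  apply h
  rw [commCoeff, Finset.prod_eq_zero (Finset.mem_univ w) (pauliTrace_eq_zero hw),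
    Finset.prod_eq_zero (Finset.mem_univ w)
      (pauliTrace_eq_zero (fun h' => hw ((eq_xor_comm _ _ _).2 h'))), sub_zero]

lemma exists_ne_zero_of_commCoeff_ne_zero {L : ℕ} [NeZero L] {τ β ρ : PSpec L}
    (h : commCoeff L τ β ρ ≠ 0) : ∃ w, τ w ≠ 0 ∧ β w ≠ 0 ∧ ρ w ≠ 0 := by
  by_contra! hw
  apply h
  rw [commCoeff, sub_eq_zero]
  refine Finset.prod_congr rfl fun w _ => pauliTrace_comm ?_
  have := hw w
  tauto

lemma commCoeff_ne_zero {L : ℕ} [NeZero L] {τ β ρ : PSpec L} {u : Site L}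
    (h : ∀ w, ρ w = τ w ^^^ β w) (hτ : τ u ≠ 0) (hβ : β u ≠ 0) (hρ : ρ u ≠ 0)
    (h0 : ∀ w, w ≠ u → τ w = 0 ∨ β w = 0 ∨ ρ w = 0) : commCoeff L τ β ρ ≠ 0 := by
  have hprod : ∏ w, pauliTrace (τ w) (β w) (ρ w) ≠ 0 :=
    Finset.prod_ne_zero_iff.2 fun w _ => pauliTrace_ne_zero (h w)
  have hneg : ∏ w, pauliTrace (τ w) (ρ w) (β w) = -∏ w, pauliTrace (τ w) (β w) (ρ w) := by
    rw [← Finset.mul_prod_erase _ _ (Finset.mem_univ u),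
      ← Finset.mul_prod_erase _ _ (Finset.mem_univ u),
      pauliTrace_anticomm hτ hβ hρ (h u), neg_mul]
    congr 2
    refine Finset.prod_congr rfl fun w hw => (pauliTrace_comm (h0 w ?_)).symm
    exact Finset.ne_of_mem_erase hw
  rw [commCoeff, hneg, sub_neg_eq_add, ← two_mul]
  exact mul_ne_zero two_ne_zero hprod

/-- The level of the anti-diagonal through a site. -/
def antidiag (L : ℕ) (u : Site L) : ZMod L := u.1 + u.2

lemma antidiag_add (L : ℕ) (u d : Site L) :
    antidiag L (u + d) = antidiag L u + antidiag L d := by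
  simp only [antidiag, Prod.fst_add, Prod.snd_add]; ring

lemma bond_left (L : ℕ) (d : Site L) (p : Fin 4) (u : Site L) : bond L d p u u = p := by
  simp [bond]

lemma bond_right (L : ℕ) (d : Site L) (p : Fin 4) (u : Site L) : bond L d p u (u + d) = p := by
  simp [bond]

lemma eq_or_eq_of_bond_ne_zero {L : ℕ} {d : Site L} {p : Fin 4} {u w : Site L}
    (h : bond L d p u w ≠ 0) : (w = u ∨ w = u + d) ∧ bond L d p u w = p := by
  unfold bond at h ⊢
  split_ifs at h ⊢ <;> simp_all

lemma xor_ne_zero {i j : Fin 4} (h : i ≠ j) : i ^^^ j ≠ 0 := by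
  revert i j; decide

lemma xor_eq_zero {i j : Fin 4} (h : i ^^^ j = 0) : i = j := by
  revert i j; decide

lemma xor_self_eq_zero (i : Fin 4) : i ^^^ i = 0 := by
  revert i; decide

lemma xor_xor_cancel (i j : Fin 4) : (i ^^^ j) ^^^ j = i := by
  revert i j; decide

lemma xor_zero_right (i : Fin 4) : i ^^^ 0 = i := by
  revert i; decide

lemma zero_xor_left (i : Fin 4) : 0 ^^^ i = i := by
  revert i; decide

/-- If removing a bond from `σ · bond` leaves a product on a single anti-diagonal
with which the bond does not commute, the removed bond is the one that was added. -/
lemma bond_unique {L : ℕ} {d d' : Site L} {p p' : Fin 4}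
    (h1 : (1 : ZMod L) ≠ 0) (hd : antidiag L d = 1) (hd0 : d ≠ 0)
    (hdd : d ≠ d') (hdd' : d + d' ≠ 0) (h2 : (2 : ZMod L) = 0 → d + d = 0)
    (hp : p ≠ 0) (hpp : p ≠ p')
    {σ ρ β : PSpec L} {u : Site L} (hσu : σ u ≠ p)
    (hσ : ∀ w, σ w ≠ 0 → antidiag L w = antidiag L u)
    (hβ : (∃ x, β = bond L d p x) ∨ ∃ x, β = bond L d' p' x)
    (hρ : ∀ w, ρ w = (σ w ^^^ bond L d p u w) ^^^ β w)
    {a : ZMod L} (ha : ∀ w, ρ w ≠ 0 → antidiag L w = a)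
    (hw : ∃ w, (σ w ^^^ bond L d p u w) ≠ 0 ∧ β w ≠ 0 ∧ ρ w ≠ 0) :
    β = bond L d p u := by
  have hlev : antidiag L (u + d) ≠ antidiag L u := by
    rw [antidiag_add, hd]; simpa using h1
  have hvu : u + d ≠ u := by simpa using hd0
  have hσv : σ (u + d) = 0 := by
    by_contra h; exact hlev (hσ _ h)
  have hτu : (σ u ^^^ bond L d p u u) ≠ 0 := by
    rw [bond_left]; exact xor_ne_zero hσu
  have hρv := hρ (u + d)
  rw [hσv, bond_right, zero_xor_left] at hρv
  by_cases h : ρ (u + d) = 0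
  · have hβv : p = β (u + d) := xor_eq_zero (hρv.symm.trans h)
    rcases hβ with ⟨x, rfl⟩ | ⟨x, rfl⟩
    · rcases (eq_or_eq_of_bond_ne_zero (hβv ▸ hp)).1 with hx | hx
      · subst hx
        by_cases hvd : u + d + d = u
        · funext w
          simp only [bond, hvd]
          split_ifs <;> rfl
        · exfalso
          have hβu : bond L d p (u + d) u = 0 := by
            by_contra hb
            rcases (eq_or_eq_of_bond_ne_zero hb).1 with hb | hb
            · exact hvu hb.symm
            · exact hvd hb.symm
          have hρu : ρ u ≠ 0 := by
            rw [hρ u, hβu, xor_zero_right]; exact hτu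
          have hlev2 : antidiag L (u + d + d) ≠ antidiag L u := by
            intro h'
            apply hvd
            have h20 : (2 : ZMod L) = 0 := by
              rw [antidiag_add, antidiag_add, hd] at h'
              linear_combination h'
            rw [add_assoc, h2 h20, add_zero]
          have hσ2 : σ (u + d + d) = 0 := by
            by_contra h; exact hlev2 (hσ _ h)
          have hb2 : bond L d p u (u + d + d) = 0 := by
            by_contra hb
            rcases (eq_or_eq_of_bond_ne_zero hb).1 with hb | hb
            · exact hvd hb
            · exact hd0 (by simpa using hb)
          have hρ2 : ρ (u + d + d) ≠ 0 := by
            rw [hρ, hσ2, hb2, bond_right, zero_xor_left, zero_xor_left]; exact hp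
          exact hlev2 ((ha _ hρ2).trans (ha _ hρu).symm)
      · rw [add_right_cancel hx]
    · exact absurd (hβv.trans (eq_or_eq_of_bond_ne_zero (hβv ▸ hp)).2) hpp
  · exfalso
    have hav := ha _ h
    have hρu : ρ u = 0 := by
      by_contra hu; exact hlev (hav.trans (ha _ hu).symm)
    have hβu : β u ≠ 0 := by
      have := xor_eq_zero ((hρ u).symm.trans hρu)
      rw [← this]; exact hτu
    obtain ⟨w, hτw, hβw, hρw⟩ := hw
    have hσw : σ w = 0 := by
      by_contra hw'
      exact hlev (hav.trans ((ha _ hρw).symm.trans (hσ _ hw')))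
    rw [hσw, zero_xor_left] at hτw
    rcases (eq_or_eq_of_bond_ne_zero hτw).1 with rfl | rfl
    · exact hρw hρu
    · rcases hβ with ⟨x, rfl⟩ | ⟨x, rfl⟩
      · rw [(eq_or_eq_of_bond_ne_zero hβw).2] at hρv
        exact h (hρv.trans (xor_self_eq_zero p))
      · rcases (eq_or_eq_of_bond_ne_zero hβu).1 with rfl | rfl <;>
          rcases (eq_or_eq_of_bond_ne_zero hβw).1 with hx | hx
        · exact hvu hx
        · exact hdd (add_left_cancel hx)
        · apply hdd'
          rw [add_assoc, add_eq_left] at hx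
          rwa [add_comm]
        · exact hvu hx

lemma exists_antidiag_of_Diag_le_one {L : ℕ} [NeZero L] {σ : PSpec L} (h : Diag L σ ≤ 1) :
    ∃ a : ZMod L, ∀ w, σ w ≠ 0 → antidiag L w = a := by
  have hne : {k | ∃ a : ZMod L, DiagBoundAt L σ a k}.Nonempty :=
    ⟨L, 0, fun u _ => ZMod.val_lt _⟩
  obtain ⟨a, ha⟩ := Nat.sInf_mem hne
  refine ⟨a, fun w hw => ?_⟩
  have h0 : (w.1 + w.2 - a).val = 0 := Nat.lt_one_iff.1 ((ha w hw).trans_le h)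
  exact sub_eq_zero.1 ((ZMod.val_eq_zero _).1 h0)

lemma trace_PauliOp_mul_opComm_sum {L : ℕ} [NeZero L] (d d' : Site L) (p p' : Fin 4)
    (J J' : ℂ) (q : PSpec L → ℂ) (τ : PSpec L) :
    Matrix.trace (PauliOp L τ * opComm L
      (-∑ u : Site L, (J • PauliOp L (bond L d p u) + J' • PauliOp L (bond L d' p' u)))
      (Qop L q)) =
    -∑ u : Site L, ∑ ρ, q ρ * (J * commCoeff L τ (bond L d p u) ρ
      + J' * commCoeff L τ (bond L d' p' u) ρ) := by
  have hbil : opComm L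
      (-∑ u : Site L, (J • PauliOp L (bond L d p u) + J' • PauliOp L (bond L d' p' u)))
      (Qop L q) = -∑ u : Site L, ∑ ρ, q ρ •
        (J • opComm L (PauliOp L (bond L d p u)) (PauliOp L ρ)
          + J' • opComm L (PauliOp L (bond L d' p' u)) (PauliOp L ρ)) := by
    rw [opComm, Qop, neg_mul, mul_neg, Finset.sum_mul_sum, Finset.sum_mul_sum,
      Finset.sum_comm (s := (Finset.univ : Finset (PSpec L))), sub_neg_eq_add, neg_add_eq_sub,
      ← neg_sub, ← Finset.sum_sub_distrib]
    congr 1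
    refine Finset.sum_congr rfl fun u _ => ?_
    rw [← Finset.sum_sub_distrib]
    refine Finset.sum_congr rfl fun ρ _ => ?_
    simp only [opComm, add_mul, mul_add, smul_mul_assoc, mul_smul_comm]
    module
  simp only [hbil, mul_neg, Finset.mul_sum, Matrix.trace_neg, Matrix.trace_sum, mul_smul_comm,
    Matrix.trace_smul, mul_add, Matrix.trace_add, trace_PauliOp_mul_opComm, smul_eq_mul]

lemma coeff_eq_zero_of_conserved {L : ℕ} [NeZero L] {d d' : Site L} {p p' : Fin 4} {J J' : ℂ}
    (h1 : (1 : ZMod L) ≠ 0) (hd : antidiag L d = 1) (hd0 : d ≠ 0)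
    (hdd : d ≠ d') (hdd' : d + d' ≠ 0) (h2 : (2 : ZMod L) = 0 → d + d = 0)
    (hp : p ≠ 0) (hp' : p' ≠ 0) (hpp : p ≠ p') (hJ : J ≠ 0)
    {q : PSpec L → ℂ} (hq : ∀ ρ, q ρ ≠ 0 → Diag L ρ ≤ 1)
    (hcons : opComm L
      (-∑ u : Site L, (J • PauliOp L (bond L d p u) + J' • PauliOp L (bond L d' p' u)))
      (Qop L q) = 0)
    {σ : PSpec L} {u : Site L} (hσ0 : σ u ≠ 0) (hσp : σ u ≠ p) : q σ = 0 := by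
  by_contra hqσ
  obtain ⟨b, hb⟩ := exists_antidiag_of_Diag_le_one (hq σ hqσ)
  have hσ : ∀ w, σ w ≠ 0 → antidiag L w = antidiag L u :=
    fun w hw => (hb w hw).trans (hb u hσ0).symm
  have hσv : σ (u + d) = 0 := by
    by_contra h
    have := hσ _ h
    rw [antidiag_add, hd] at this
    exact h1 (by simpa using this)
  set τ : PSpec L := fun w => σ w ^^^ bond L d p u w with hτ
  have key : ∀ β ρ : PSpec L, ((∃ x, β = bond L d p x) ∨ ∃ x, β = bond L d' p' x) →
      q ρ ≠ 0 → commCoeff L τ β ρ ≠ 0 → β = bond L d p u ∧ ρ = σ := by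
    intro β ρ hβ hqρ hc
    obtain ⟨a, ha⟩ := exists_antidiag_of_Diag_le_one (hq ρ hqρ)
    have hρ := eq_xor_of_commCoeff_ne_zero hc
    have hβ' := bond_unique h1 hd hd0 hdd hdd' h2 hp hpp hσp hσ hβ hρ ha
      (exists_ne_zero_of_commCoeff_ne_zero hc)
    refine ⟨hβ', funext fun w => ?_⟩
    rw [hρ w, hβ']
    exact xor_xor_cancel (σ w) (bond L d p u w)
  have hc : commCoeff L τ (bond L d p u) σ ≠ 0 := by
    refine commCoeff_ne_zero (u := u) ?_ ?_ ?_ hσ0 ?_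
    · exact fun w => (xor_xor_cancel (σ w) (bond L d p u w)).symm
    · simp only [hτ, bond_left]
      exact xor_ne_zero hσp
    · rwa [bond_left]
    · intro w hw
      by_contra! h
      rcases (eq_or_eq_of_bond_ne_zero h.2.1).1 with h' | h'
      · exact hw h'
      · exact h.2.2 (h' ▸ hσv)
  have htr := trace_PauliOp_mul_opComm_sum d d' p p' J J' q τ
  rw [hcons, mul_zero, Matrix.trace_zero, eq_comm, neg_eq_zero] at htr
  have hterm : ∀ x : Site L, ∑ ρ, q ρ * (J * commCoeff L τ (bond L d p x) ρ
      + J' * commCoeff L τ (bond L d' p' x) ρ) =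
      if bond L d p x = bond L d p u then q σ * (J * commCoeff L τ (bond L d p u) σ) else 0 := by
    intro x
    have hz' : ∀ ρ, q ρ * commCoeff L τ (bond L d' p' x) ρ = 0 := by
      intro ρ
      by_contra h
      obtain ⟨hqρ, hcρ⟩ := mul_ne_zero_iff.1 h
      have := congrFun (key _ ρ (Or.inr ⟨x, rfl⟩) hqρ hcρ).1 x
      rw [bond_left] at this
      have h3 := (eq_or_eq_of_bond_ne_zero (this ▸ hp')).2
      exact hpp (h3.symm.trans this.symm)
    have hz : ∀ ρ, ¬ (bond L d p x = bond L d p u ∧ ρ = σ) →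
        q ρ * commCoeff L τ (bond L d p x) ρ = 0 := by
      intro ρ hn
      by_contra h
      obtain ⟨hqρ, hcρ⟩ := mul_ne_zero_iff.1 h
      exact hn (key _ ρ (Or.inl ⟨x, rfl⟩) hqρ hcρ)
    rw [Finset.sum_eq_single σ]
    · split_ifs with h
      · rw [h]; linear_combination J' * hz' σ
      · linear_combination J' * hz' σ + J * hz σ (fun h' => h h'.1)
    · intro ρ _ hρ
      linear_combination J' * hz' ρ + J * hz ρ (fun h' => hρ h'.2)
    · intro h; exact absurd (Finset.mem_univ σ) h
  rw [Finset.sum_congr rfl fun x _ => hterm x, ← Finset.sum_filter, Finset.sum_const,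
    nsmul_eq_mul, mul_eq_zero, Nat.cast_eq_zero, Finset.card_eq_zero] at htr
  rcases htr with h | h
  · have : u ∈ Finset.univ.filter fun x => bond L d p x = bond L d p u := by simp
    rw [h] at this
    simp at this
  · exact mul_ne_zero hqσ (mul_ne_zero hJ hc) h

/-- There are no local conserved quantities of the compass
Hamiltonian with diagonal length `k̄ = 1`: all coefficients of Pauli products
of diagonal length `1` vanish. -/
theorem no_local_conserved_quantity_diag_one
    (L : ℕ) [NeZero L] (hL : 2 ≤ L) (Jx Jy : ℝ) (hJx : Jx ≠ 0) (hJy : Jy ≠ 0)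
    (q : PSpec L → ℂ)
    (hsupp : ∀ σ : PSpec L, q σ ≠ 0 → σ ≠ 0 ∧ Diag L σ ≤ 1)
    (hcons : opComm L (Hcompass L Jx Jy) (Qop L q) = 0) :
    ∀ σ : PSpec L, Diag L σ = 1 → q σ = 0 := by
  intro σ hσ
  by_contra hqσ
  have : Fact (1 < L) := ⟨hL⟩
  have h1 : (1 : ZMod L) ≠ 0 := one_ne_zero
  have hq : ∀ ρ, q ρ ≠ 0 → Diag L ρ ≤ 1 := fun ρ h => (hsupp ρ h).2
  obtain ⟨u, hu⟩ := Function.ne_iff.1 (hsupp σ hqσ).1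
  rw [Pi.zero_apply] at hu
  by_cases hX : σ u = 1
  · refine hqσ (coeff_eq_zero_of_conserved (d := (0, 1)) (d' := (1, 0)) (p := 2) (p' := 1)
      (J := Jy) (J' := Jx) h1 (by simp [antidiag]) (by simp) (by simp) (by simp)
      (fun h => by simp [one_add_one_eq_two, h]) (by decide) (by decide) (by decide)
      (by exact_mod_cast hJy) hq ?_ hu (by rw [hX]; decide))
    simp only [add_comm ((Jy : ℂ) • _)]
    exact hcons
  · exact hqσ (coeff_eq_zero_of_conserved (d := (1, 0)) (d' := (0, 1)) (p := 1) (p' := 2)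
      (J := Jx) (J' := Jy) h1 (by simp [antidiag]) (by simp) (by simp) (by simp)
      (fun h => by simp [one_add_one_eq_two, h]) (by decide) (by decide) (by decide)
      (by exact_mod_cast hJx) hq hcons hu hX)
end
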